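/- arXiv:2004.14866 — 4 statements merged into one kernel-verified Lean document; each statement's English description precedes it below -/
import Mathlib

section
/- For any real numbers α, β with α ≥ β > 0, one has α + 1/β − 1 ≥ 1, and moreover α − ln β − 1 ≥ (√3/(2+√3))·ln(α + 1/β − 1) ≥ (6/13)·ln(α + 1/β − 1). -/
theorem aux_deriv (c x : ℝ) (hx : 0 < x) (hc : c ^ 2 + 6 * c = 3) :
    HasDerivAt (fun b : ℝ => b - 1 - (1 - c) * Real.log b - c * Real.log (b ^ 2 - b + 1))
      ((x - 1) * ((x - (1 + c) / 2) ^ 2 / (x * (x ^ 2 - x + 1)))) x := by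
  have hq : 0 < x ^ 2 - x + 1 := by nlinarith [sq_nonneg (x - 1 / 2)]
  have h1 := (Real.hasDerivAt_log hx.ne').const_mul (1 - c)
  have h0 : HasDerivAt (fun b : ℝ => b ^ 2 - b + 1) (2 * x - 1) x := by
    simpa using (((hasDerivAt_id x).pow 2).sub (hasDerivAt_id x)).add_const 1
  have h2 := (h0.log hq.ne').const_mul c
  have h3 := (((hasDerivAt_id x).sub_const 1).sub h1).sub h2
  refine h3.congr_deriv ?_
  have hx' := hx.ne'
  have hq' := hq.ne'
  have e : (1 + c) ^ 2 = 4 * (1 - c) := by linarith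
  have e2 : (x - (1 + c) / 2) ^ 2 = x ^ 2 - (1 + c) * x + (1 - c) := by linarith
  rw [e2, eq_comm, ← mul_div_assoc, div_eq_iff (by positivity)]
  have : (1 - (1 - c) * x⁻¹ - c * ((2 * x - 1) / (x ^ 2 - x + 1))) * (x * (x ^ 2 - x + 1))
    = x * (x ^ 2 - x + 1) - (1 - c) * (x ^ 2 - x + 1) - c * (2 * x - 1) * x := by
    generalize x ^ 2 - x + 1 = q at *
    field_simp
  rw [this]
  ring

theorem aux_one (c b : ℝ) (hb : 0 < b) (hc : c ^ 2 + 6 * c = 3) :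
    0 ≤ b - 1 - (1 - c) * Real.log b - c * Real.log (b ^ 2 - b + 1) := by
  have hpos : ∀ x : ℝ, 0 < x → 0 ≤ (x - (1 + c) / 2) ^ 2 / (x * (x ^ 2 - x + 1)) := by
    intro x hx
    have hq : 0 < x ^ 2 - x + 1 := by nlinarith [sq_nonneg (x - 1 / 2)]
    positivity
  rcases le_total b 1 with h | h
  · have := antitoneOn_of_hasDerivWithinAt_nonpos (convex_Icc b 1)
      (fun x hx => (aux_deriv c x (hb.trans_le hx.1) hc).continuousAt.continuousWithinAt)
      (fun x hx => (aux_deriv c x (hb.trans_le (interior_subset hx).1) hc).hasDerivWithinAt)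
      (fun x hx => mul_nonpos_of_nonpos_of_nonneg
        (sub_nonpos.2 (interior_subset hx).2) (hpos x (hb.trans_le (interior_subset hx).1)))
    simpa using this (Set.left_mem_Icc.2 h) (Set.right_mem_Icc.2 h) h
  · have := monotoneOn_of_hasDerivWithinAt_nonneg (convex_Icc 1 b)
      (fun x hx => (aux_deriv c x (one_pos.trans_le hx.1) hc).continuousAt.continuousWithinAt)
      (fun x hx => (aux_deriv c x (one_pos.trans_le (interior_subset hx).1) hc).hasDerivWithinAt)
      (fun x hx => mul_nonneg
        (sub_nonneg.2 (interior_subset hx).1) (hpos x (one_pos.trans_le (interior_subset hx).1)))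
    simpa using this (Set.left_mem_Icc.2 h) (Set.right_mem_Icc.2 h) h

theorem aux_log_inequality (α β : ℝ) (hβ : 0 < β) (hαβ : β ≤ α) :
    1 ≤ α + 1 / β - 1 ∧
    α - Real.log β - 1 ≥
      (Real.sqrt 3 / (2 + Real.sqrt 3)) * Real.log (α + 1 / β - 1) ∧
    (Real.sqrt 3 / (2 + Real.sqrt 3)) * Real.log (α + 1 / β - 1) ≥
      (6 / 13) * Real.log (α + 1 / β - 1) := by
  have hs : Real.sqrt 3 ^ 2 = 3 := Real.sq_sqrt (by norm_num)
  have hs0 : 0 ≤ Real.sqrt 3 := Real.sqrt_nonneg 3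
  have hsl : 12 / 7 ≤ Real.sqrt 3 := Real.le_sqrt_of_sq_le (by norm_num)
  have hcs : Real.sqrt 3 / (2 + Real.sqrt 3) = 2 * Real.sqrt 3 - 3 := by
    rw [div_eq_iff (by positivity)]; linarith
  have hcl : 6 / 13 ≤ Real.sqrt 3 / (2 + Real.sqrt 3) := by
    rw [div_le_div_iff₀ (by norm_num) (by positivity)]; linarith
  have hcu : Real.sqrt 3 / (2 + Real.sqrt 3) ≤ 1 := by
    rw [div_le_one (by positivity)]; linarith
  have hc : (Real.sqrt 3 / (2 + Real.sqrt 3)) ^ 2 + 6 * (Real.sqrt 3 / (2 + Real.sqrt 3)) = 3 := by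
    rw [hcs]; linarith
  generalize Real.sqrt 3 / (2 + Real.sqrt 3) = c at *
  have hq : 0 < β ^ 2 - β + 1 := by nlinarith [sq_nonneg (β - 1 / 2)]
  have hx : β + 1 / β - 1 = (β ^ 2 - β + 1) / β := by field_simp; ring
  have hx1 : 1 ≤ β + 1 / β - 1 := by
    rw [hx, le_div_iff₀ hβ]; nlinarith [sq_nonneg (β - 1)]
  have h1 : 1 ≤ α + 1 / β - 1 := by linarith
  refine ⟨h1, ?_, mul_le_mul_of_nonneg_right hcl (Real.log_nonneg h1)⟩
  have hb := aux_one c β hβ hc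
  have hl : Real.log (β + 1 / β - 1) = Real.log (β ^ 2 - β + 1) - Real.log β := by
    rw [hx, Real.log_div hq.ne' hβ.ne']
  have hd : Real.log (α + 1 / β - 1) ≤ Real.log (β + 1 / β - 1) + (α - β) := by
    have hp : 0 < β + 1 / β - 1 := by linarith
    have h2 := Real.log_le_sub_one_of_pos (div_pos (by linarith : 0 < α + 1 / β - 1) hp)
    rw [Real.log_div (by linarith) hp.ne'] at h2
    have h3 : (α + 1 / β - 1) / (β + 1 / β - 1) ≤ 1 + (α - β) := by
      rw [div_le_iff₀ hp]
      nlinarith [mul_nonneg (sub_nonneg.2 hαβ) (sub_nonneg.2 hx1)]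
    linarith
  rw [hl] at hd
  have h4 := mul_le_mul_of_nonneg_left hd (by linarith : 0 ≤ c)
  have h5 := mul_nonneg (sub_nonneg.2 hcu) (sub_nonneg.2 hαβ)
  linarith
end

section
/- Let A, G be symmetric positive definite n×n matrices with (1/ξ)·A ⪯ G ⪯ η·A for some ξ, η ≥ 1. Then, for any τ ∈ [0,1] and any nonzero u ∈ ℝ^n, ψ(G, A) − ψ(Broyd_τ(A, G, u), A) ≥ (6/13)·ln(1 + (τ/(ξη) + 1 − τ)·ν(A,G,u)²). -/
open Matrix Finset

/-- The Broyden family update of a Hessian approximation `G` with respect to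
the target matrix `A` along direction `u`, parameterized by `τ`. -/
noncomputable def broyd {n : ℕ} (τ : ℝ) (A G : Matrix (Fin n) (Fin n) ℝ) (u : Fin n → ℝ) :
    Matrix (Fin n) (Fin n) ℝ :=
  if u = 0 then G
  else
    let aUU : ℝ := u ⬝ᵥ A.mulVec u
    let gUU : ℝ := u ⬝ᵥ G.mulVec u
    let agaUU : ℝ := u ⬝ᵥ (A * G⁻¹ * A).mulVec u
    let ρ : ℝ := gUU / aUU
    let φ : ℝ := τ * (aUU / agaUU) / (τ * (aUU / agaUU) + (1 - τ) * ρ)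
    φ • (G - aUU⁻¹ • (A * vecMulVec u u * G + G * vecMulVec u u * A)
          + ((ρ + 1) / aUU) • (A * vecMulVec u u * A)) +
    (1 - φ) • (G - gUU⁻¹ • (G * vecMulVec u u * G) + aUU⁻¹ • (A * vecMulVec u u * A))

/-- `psdLE P Q` (i.e. `P ⪯ Q`) : the matrix `Q - P` is positive semidefinite. -/
def psdLE {n : ℕ} (P Q : Matrix (Fin n) (Fin n) ℝ) : Prop := (Q - P).PosSemidef

/-- The closeness measure ν(A, G, u). -/
noncomputable def nuMeas {n : ℕ} (A G : Matrix (Fin n) (Fin n) ℝ) (u : Fin n → ℝ) : ℝ :=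
  Real.sqrt ((u ⬝ᵥ ((G - A) * G⁻¹ * (G - A)).mulVec u) / (u ⬝ᵥ A.mulVec u))

/-- The log-det barrier V(A, G) = ln det (A⁻¹ G). -/
noncomputable def logDetBarrier {n : ℕ} (A G : Matrix (Fin n) (Fin n) ℝ) : ℝ :=
  Real.log (A⁻¹ * G).det

/-- The augmented log-det barrier ψ(G, A) = ln det (A⁻¹ G) - tr (G⁻¹ (G - A)). -/
noncomputable def psiBarrier {n : ℕ} (G A : Matrix (Fin n) (Fin n) ℝ) : ℝ :=
  Real.log (A⁻¹ * G).det - (G⁻¹ * (G - A)).trace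


lemma aux_scalar_mono (c : ℝ) (hc : c = 6/13) :
    ∀ x : ℝ, 0 < x → 0 ≤ x⁻¹ - 1 + Real.log x - c * Real.log (x⁻¹ + x - 1) := by
  have hpos : ∀ x : ℝ, 0 < x → 0 < x⁻¹ + x - 1 := by
    intro x hx
    have : x⁻¹ + x - 1 = (x^2 - x + 1) / x := by field_simp; ring
    rw [this]
    apply div_pos _ hx
    nlinarith [sq_nonneg (x - 1/2)]
  let h : ℝ → ℝ := fun x => x⁻¹ - 1 + Real.log x - c * Real.log (x⁻¹ + x - 1)
  have hd : ∀ x : ℝ, 0 < x → HasDerivAt h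
      ((x - 1) * ((x^2 - x + 1 - c * (x^2 + x)) / (x^2 * (x^2 - x + 1)))) x := by
    intro x hx
    have h1 := hasDerivAt_inv hx.ne'
    have h2 := Real.hasDerivAt_log hx.ne'
    have h3 := (((h1.add (hasDerivAt_id x)).sub_const 1).log (hpos x hx).ne').const_mul c
    have h4 := ((h1.sub_const 1).add h2).sub h3
    refine h4.congr_deriv ?_
    have hq : x^2 - x + 1 ≠ 0 := by nlinarith [sq_nonneg (x - 1/2)]
    have e : x⁻¹ + x - 1 = (x^2 - x + 1) / x := by field_simp; ring
    simp only [Pi.add_apply, id]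
    rw [e]
    generalize x^2 - x + 1 = m at hq
    field_simp
    ring
  have hbr : ∀ x : ℝ, 0 < x → 0 ≤ (x^2 - x + 1 - c * (x^2 + x)) / (x^2 * (x^2 - x + 1)) := by
    intro x hx
    apply div_nonneg
    · rw [hc]; nlinarith [sq_nonneg (x - 19/14)]
    · have : 0 ≤ x^2 - x + 1 := by nlinarith [sq_nonneg (x - 1/2)]
      positivity
  have h1 : h 1 = 0 := by simp [h]
  intro x hx
  change 0 ≤ h x
  rw [← h1]
  rcases le_total x 1 with hx1 | hx1
  · have : AntitoneOn h (Set.Icc x 1) := by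
      apply antitoneOn_of_deriv_nonpos (convex_Icc _ _)
      · intro z hz
        exact (hd z (lt_of_lt_of_le hx hz.1)).continuousAt.continuousWithinAt
      · intro z hz
        rw [interior_Icc] at hz
        exact (hd z (lt_trans hx hz.1)).differentiableAt.differentiableWithinAt
      · intro z hz
        rw [interior_Icc] at hz
        rw [(hd z (lt_trans hx hz.1)).deriv]
        exact mul_nonpos_of_nonpos_of_nonneg (by linarith [hz.2]) (hbr z (lt_trans hx hz.1))
    exact this ⟨le_refl _, hx1⟩ ⟨hx1, le_refl _⟩ hx1
  · have : MonotoneOn h (Set.Icc 1 x) := by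
      apply monotoneOn_of_deriv_nonneg (convex_Icc _ _)
      · intro z hz
        exact (hd z (lt_of_lt_of_le one_pos hz.1)).continuousAt.continuousWithinAt
      · intro z hz
        rw [interior_Icc] at hz
        exact (hd z (lt_trans one_pos hz.1)).differentiableAt.differentiableWithinAt
      · intro z hz
        rw [interior_Icc] at hz
        rw [(hd z (lt_trans one_pos hz.1)).deriv]
        exact mul_nonneg (by linarith [hz.1]) (hbr z (lt_trans one_pos hz.1))
    exact this ⟨le_refl _, hx1⟩ ⟨hx1, le_refl _⟩ hx1

lemma aux_scalar (α x : ℝ) (hx : 0 < x) (hαx : x⁻¹ ≤ α) :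
    (6/13) * Real.log (α + x - 1) ≤ α - 1 + Real.log x := by
  have h0 := aux_scalar_mono (6/13) rfl x hx
  have h1 : 1 ≤ x⁻¹ + x - 1 := by
    have : x⁻¹ + x - 1 - 1 = (x - 1)^2 / x := by field_simp; ring
    have h2 : 0 ≤ (x - 1)^2 / x := by positivity
    linarith
  set b := x⁻¹ + x - 1
  have h2 : Real.log (α + x - 1) ≤ Real.log b + (α - x⁻¹) := by
    have hb : 0 < b := by linarith
    have hb2 : 0 < α + x - 1 := by simp only [b] at h1; linarith
    have h3 := Real.log_le_sub_one_of_pos (div_pos hb2 hb)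
    rw [Real.log_div hb2.ne' hb.ne'] at h3
    have h4 : (α + x - 1) / b - 1 ≤ α - x⁻¹ := by
      have : (α + x - 1) / b - 1 = (α - x⁻¹) / b := by
        rw [div_sub_one hb.ne']; congr 1; simp only [b]; ring
      rw [this]
      exact div_le_self (by linarith) h1
    linarith
  linarith

lemma aux_final (a g q w ξ η τ κ : ℝ) (ha : 0 < a) (hg : 0 < g) (hq : 0 < q)
    (hξ : 1 ≤ ξ) (hη : 1 ≤ η) (h0 : 0 ≤ τ) (h1 : τ ≤ 1)
    (hagq : a^2 ≤ g * q) (hqaw : q^2 ≤ a * w) (hqa : q ≤ ξ * a)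
    (hν0 : 0 ≤ g - 2*a + q)
    (hz : g - 2 * a + q ≤ η * (w - 2 * q + a)) (hκ : κ = (g - 2*a+q)/a) :
    (6/13) * Real.log (1 + (τ / (ξ * η) + 1 - τ) * κ) ≤
      Real.log (τ * (a / q) + (1 - τ) * (g / a)) + τ * (w/q - 1) + (1-τ) * (q/a - 1) := by
  set x := τ * (a / q) + (1 - τ) * (g / a) with hxdef
  set α := τ * (w/q) + (1-τ) * (q/a) with hαdef
  have hag : a / q ≤ g / a := by rw [div_le_div_iff₀ hq ha]; nlinarith
  have hqw : q / a ≤ w / q := by rw [div_le_div_iff₀ ha hq]; nlinarith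
  have hxge : a / q ≤ x := by nlinarith
  have hαge : q / a ≤ α := by nlinarith
  have haq : 0 < a / q := by positivity
  have hx : 0 < x := by linarith
  have hinv : x⁻¹ ≤ α := by
    have : x⁻¹ ≤ (a/q)⁻¹ := inv_anti₀ haq hxge
    rw [inv_div] at this
    linarith
  have key := aux_scalar α x hx hinv
  have hκ0 : 0 ≤ κ := by rw [hκ]; positivity
  have hk : κ / (ξ * η) ≤ w / q + a / q - 2 := by
    have e : w / q + a / q - 2 = (w - 2 * q + a) / q := by field_simp; ring
    rw [e, hκ, div_div, div_le_div_iff₀ (by positivity) hq]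
    have hN : 0 ≤ w - 2 * q + a := by
      by_contra hneg
      push Not at hneg
      nlinarith
    calc (g - 2 * a + q) * q ≤ (η * (w - 2 * q + a)) * (ξ * a) := by
          apply mul_le_mul hz hqa hq.le (by positivity)
      _ = _ := by ring
  have hle : 1 + (τ / (ξ * η) + 1 - τ) * κ ≤ α + x - 1 := by
    have e1 : 1 + (τ / (ξ * η) + 1 - τ) * κ = 1 + τ * (κ / (ξ * η)) + (1 - τ) * κ := by ring
    have e2 : κ = g / a + q / a - 2 := by rw [hκ]; field_simp; ring
    have := mul_le_mul_of_nonneg_left hk h0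
    rw [e1]
    have e3 : (1 - τ) * κ = (1 - τ) * (g / a + q / a - 2) := by rw [← e2]
    rw [e3]
    simp only [hxdef, hαdef]
    linarith
  have hpos : 0 < 1 + (τ / (ξ * η) + 1 - τ) * κ := by
    have : 0 ≤ τ / (ξ * η) + 1 - τ := by
      have : 0 ≤ τ / (ξ * η) := by positivity
      linarith
    positivity
  have hl := Real.log_le_log hpos hle
  have : τ * (w/q - 1) + (1-τ) * (q/a - 1) = α - 1 := by rw [hαdef]; ring
  linarith

lemma aux_inv {n : ℕ} (G : Matrix (Fin n) (Fin n) ℝ) (Y : Matrix (Fin n) (Fin 2) ℝ)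
    (C D : Matrix (Fin 2) (Fin 2) ℝ) (hG : IsUnit G.det)
    (h : C + D + C * (Yᵀ * G * Y) * D = 0) :
    (G + G * Y * C * Yᵀ * G) * (G⁻¹ + Y * D * Yᵀ) = 1 := by
  have e : (G + G * Y * C * Yᵀ * G) * (G⁻¹ + Y * D * Yᵀ) =
      G * G⁻¹ + G * Y * D * Yᵀ + G * Y * C * Yᵀ * (G * G⁻¹)
        + G * Y * (C * (Yᵀ * G * Y) * D) * Yᵀ := by
    simp only [Matrix.add_mul, Matrix.mul_add, Matrix.mul_assoc]
    abel
  rw [e, Matrix.mul_nonsing_inv _ hG, Matrix.mul_one]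
  have e2 : G * Y * D * Yᵀ + G * Y * C * Yᵀ + G * Y * (C * (Yᵀ * G * Y) * D) * Yᵀ =
    G * Y * (C + D + C * (Yᵀ * G * Y) * D) * Yᵀ := by
    simp only [Matrix.add_mul, Matrix.mul_add]
    abel
  rw [add_assoc, add_assoc, ← add_assoc (G * Y * D * Yᵀ), e2, h]
  simp

lemma aux_det {n : ℕ} (G : Matrix (Fin n) (Fin n) ℝ) (Y : Matrix (Fin n) (Fin 2) ℝ)
    (C : Matrix (Fin 2) (Fin 2) ℝ) :
    (G + G * Y * C * Yᵀ * G).det = G.det * (1 + C * (Yᵀ * G * Y)).det := by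
  have : G + G * Y * C * Yᵀ * G = G * (1 + Y * (C * Yᵀ * G)) := by
    simp only [Matrix.mul_add, Matrix.mul_assoc, Matrix.mul_one]
  rw [this, Matrix.det_mul, Matrix.det_one_add_mul_comm]
  simp only [Matrix.mul_assoc]

lemma aux_mulT {n : ℕ} (M : Matrix (Fin n) (Fin n) ℝ) (y u : Fin n → ℝ) :
    M * (Matrix.of ![y, u])ᵀ = (Matrix.of ![M *ᵥ y, M *ᵥ u])ᵀ := by
  ext i j
  fin_cases j <;> simp [Matrix.mul_apply, Matrix.mulVec, dotProduct]

lemma aux_mul {n : ℕ} (M : Matrix (Fin n) (Fin n) ℝ) (hM : Mᵀ = M) (y u : Fin n → ℝ) :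
    (Matrix.of ![y, u]) * M = (Matrix.of ![M *ᵥ y, M *ᵥ u]) := by
  have := congrArg Matrix.transpose (aux_mulT M y u)
  rw [Matrix.transpose_mul, hM, Matrix.transpose_transpose, Matrix.transpose_transpose] at this
  exact this

lemma aux_gram {n : ℕ} (M : Matrix (Fin n) (Fin n) ℝ) (y u : Fin n → ℝ) :
    (Matrix.of ![y, u]) * M * (Matrix.of ![y, u])ᵀ =
      !![y ⬝ᵥ M *ᵥ y, y ⬝ᵥ M *ᵥ u; u ⬝ᵥ M *ᵥ y, u ⬝ᵥ M *ᵥ u] := by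
  rw [Matrix.mul_assoc, aux_mulT]
  ext i j
  fin_cases i <;> fin_cases j <;> simp [Matrix.mul_apply, dotProduct]

lemma aux_symm {n : ℕ} (M : Matrix (Fin n) (Fin n) ℝ) (hM : Mᵀ = M) (x y : Fin n → ℝ) :
    x ⬝ᵥ M *ᵥ y = y ⬝ᵥ M *ᵥ x := by
  rw [Matrix.dotProduct_mulVec, ← Matrix.mulVec_transpose, hM, dotProduct_comm]

lemma aux_cs {n : ℕ} (M : Matrix (Fin n) (Fin n) ℝ) (hM : M.PosDef) (x y : Fin n → ℝ) :
    (x ⬝ᵥ M *ᵥ y)^2 ≤ (x ⬝ᵥ M *ᵥ x) * (y ⬝ᵥ M *ᵥ y) := by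
  have hs : Mᵀ = M := (by simpa using hM.isHermitian : M.IsSymm)
  have h : ∀ t : ℝ, 0 ≤ (y ⬝ᵥ M *ᵥ y) * (t * t) + (2 * (x ⬝ᵥ M *ᵥ y)) * t + x ⬝ᵥ M *ᵥ x := by
    intro t
    have h1 := hM.posSemidef.dotProduct_mulVec_nonneg (x + t • y)
    simp only [star_trivial, Matrix.mulVec_add, Matrix.mulVec_smul, add_dotProduct,
      dotProduct_add, smul_dotProduct, dotProduct_smul, smul_eq_mul] at h1
    rw [aux_symm M hs y x] at h1
    linarith
  have := discrim_le_zero h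
  rw [discrim] at this
  nlinarith

lemma aux_trace {n : ℕ} (X A : Matrix (Fin n) (Fin n) ℝ) (hX : IsUnit X.det) :
    (X⁻¹ * (X - A)).trace = n - (X⁻¹ * A).trace := by
  rw [Matrix.mul_sub, Matrix.nonsing_inv_mul _ hX, Matrix.trace_sub, Matrix.trace_one]
  simp

lemma aux_broyd {n : ℕ} (A G : Matrix (Fin n) (Fin n) ℝ) (hA : Aᵀ = A) (hG : Gᵀ = G)
    (y u : Fin n → ℝ) (hu : u ≠ 0) (hy : G *ᵥ y = A *ᵥ u) (τ a g q φ : ℝ)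
    (ha : u ⬝ᵥ A *ᵥ u = a) (hg : u ⬝ᵥ G *ᵥ u = g) (hq : u ⬝ᵥ (A * G⁻¹ * A) *ᵥ u = q)
    (hφ : φ = τ * (a / q) / (τ * (a / q) + (1 - τ) * (g / a))) :
    broyd τ A G u = G + G * (Matrix.of ![y, u])ᵀ *
      !![φ * ((g / a + 1) / a) + (1 - φ) * a⁻¹, - φ * a⁻¹; - φ * a⁻¹, -(1 - φ) * g⁻¹]
        * ((Matrix.of ![y, u])ᵀ)ᵀ * G := by
  simp only [broyd, if_neg hu, ha, hg, hq, ← hφ]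
  rw [Matrix.transpose_transpose, Matrix.mul_assoc _ (Matrix.of ![y, u]) G, aux_mul G hG, aux_mulT, hy]
  simp only [Matrix.mul_vecMulVec, Matrix.vecMulVec_mul, ← Matrix.mulVec_transpose, hA, hG]
  ext i j
  simp [Matrix.mul_apply, Fin.sum_univ_two, Matrix.vecMulVec_apply]
  ring

lemma aux_CD (a g q τ T φ : ℝ) (ha : a ≠ 0) (hg : g ≠ 0) (hq : q ≠ 0) (hT : T ≠ 0)
    (hTd : T = τ * (a / q) + (1 - τ) * (g / a)) (hφ : φ = τ * (a / q) / T) :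
    let C := !![φ * ((g / a + 1) / a) + (1 - φ) * a⁻¹, - φ * a⁻¹; - φ * a⁻¹, -(1 - φ) * g⁻¹]
    let D := !![- τ / q, - (1 - τ) / a; -(1 - τ) / a, τ / a + (1 - τ) * ((q / a + 1) / a)]
    let Γ := !![q, a; a, g]
    C + D + C * Γ * D = 0 ∧ (1 + C * Γ).det = T⁻¹ := by
  intro C D Γ
  have hφ1 : 1 - φ = (1 - τ) * (g / a) / T := by
    rw [hφ, one_sub_div hT]; congr 1; rw [hTd]; ring
  have hφT : φ * T = τ * (a / q) := by rw [hφ]; field_simp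
  constructor
  · simp only [C, D, Γ, hφ1]
    rw [hφ]
    have hTd' : T * (q * a) = τ * a^2 + (1 - τ) * g * q := by rw [hTd]; field_simp
    ext i j
    fin_cases i <;> fin_cases j <;> simp [Matrix.mul_apply, Fin.sum_univ_two] <;> field_simp
    · linear_combination (-τ * a) * hTd'
    · linear_combination ((τ - 1) * a) * hTd'
    · linear_combination (τ - 1) * hTd'
    · linear_combination (τ * a + (1 - τ) * (q + a)) * hTd'
  · simp only [C, Γ, hφ1]
    rw [hφ]
    rw [Matrix.det_fin_two]
    have hTd' : T * (q * a) = τ * a^2 + (1 - τ) * g * q := by rw [hTd]; field_simp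
    simp [Matrix.mul_apply, Fin.sum_univ_two]
    field_simp
    linear_combination ((a ^ 2 * q * T + (q * (τ * a * (g + a) + q * g * (1 - τ)) + -(τ * a ^ 3)))
      - a ^ 2 * q) * hTd'

theorem psi_barrier_progress {n : ℕ} (hn : 1 ≤ n)
    (A G : Matrix (Fin n) (Fin n) ℝ) (hA : A.PosDef) (hG : G.PosDef)
    (ξ η : ℝ) (hξ : 1 ≤ ξ) (hη : 1 ≤ η)
    (hlow : psdLE (ξ⁻¹ • A) G) (hup : psdLE G (η • A))
    (τ : ℝ) (hτ : τ ∈ Set.Icc (0 : ℝ) 1) (u : Fin n → ℝ) (hu : u ≠ 0) :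
    psiBarrier G A - psiBarrier (broyd τ A G u) A ≥
      (6 / 13) * Real.log (1 + (τ / (ξ * η) + 1 - τ) * nuMeas A G u ^ 2) := by
  have hAs : Aᵀ = A := (by simpa using hA.isHermitian : A.IsSymm)
  have hGs : Gᵀ = G := (by simpa using hG.isHermitian : G.IsSymm)
  have hGu : IsUnit G.det := hG.det_pos.ne'.isUnit
  have hAu : IsUnit A.det := hA.det_pos.ne'.isUnit
  obtain ⟨y, hydef⟩ : ∃ y, y = G⁻¹ *ᵥ (A *ᵥ u) := ⟨_, rfl⟩
  have hy : G *ᵥ y = A *ᵥ u := by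
    rw [hydef, Matrix.mulVec_mulVec, Matrix.mul_nonsing_inv _ hGu, Matrix.one_mulVec]
  obtain ⟨a, ha⟩ : ∃ a, u ⬝ᵥ A *ᵥ u = a := ⟨_, rfl⟩
  obtain ⟨g, hg⟩ : ∃ a, u ⬝ᵥ G *ᵥ u = a := ⟨_, rfl⟩
  obtain ⟨q, hq⟩ : ∃ a, y ⬝ᵥ A *ᵥ u = a := ⟨_, rfl⟩
  obtain ⟨w, hw⟩ : ∃ a, y ⬝ᵥ A *ᵥ y = a := ⟨_, rfl⟩
  have hq2 : u ⬝ᵥ A *ᵥ y = q := by rw [aux_symm A hAs, hq]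
  have hq3 : y ⬝ᵥ G *ᵥ y = q := by rw [hy, hq]
  have ha2 : u ⬝ᵥ G *ᵥ y = a := by rw [hy, ha]
  have ha3 : y ⬝ᵥ G *ᵥ u = a := by rw [aux_symm G hGs, ha2]
  have hq4 : u ⬝ᵥ (A * G⁻¹ * A) *ᵥ u = q := by
    rw [← hq2, hydef]; simp only [Matrix.mulVec_mulVec, Matrix.mul_assoc]
  have ha0 : 0 < a := by simpa [ha] using hA.dotProduct_mulVec_pos hu
  have hg0 : 0 < g := by simpa [hg] using hG.dotProduct_mulVec_pos hu
  have hy0 : y ≠ 0 := by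
    rintro rfl
    rw [Matrix.mulVec_zero] at hy
    rw [← hy] at ha
    simp at ha
    linarith
  have hq0 : 0 < q := by simpa [hq3] using hG.dotProduct_mulVec_pos hy0
  have c1 : a^2 ≤ g * q := by
    have := aux_cs G hG u y
    rwa [ha2, hg, hq3] at this
  have c2 : q^2 ≤ a * w := by
    have := aux_cs A hA u y
    rwa [hq2, ha, hw] at this
  have c3 : q ≤ ξ * a := by
    have h1 := hlow.dotProduct_mulVec_nonneg y
    simp only [star_trivial, Matrix.sub_mulVec, dotProduct_sub, Matrix.smul_mulVec,
      dotProduct_smul, smul_eq_mul, hq3, hw] at h1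
    have h2 : w ≤ ξ * q := by
      have := mul_le_mul_of_nonneg_left (sub_nonneg.mp h1) (by linarith : 0 ≤ ξ)
      rwa [← mul_assoc, mul_inv_cancel₀ (by linarith), one_mul] at this
    nlinarith
  have c4 : (y - u) ⬝ᵥ G *ᵥ (y - u) = g - 2 * a + q := by
    simp only [Matrix.mulVec_sub, sub_dotProduct, dotProduct_sub, hq3, ha2, ha3, hg]; ring
  have c5 : (y - u) ⬝ᵥ A *ᵥ (y - u) = w - 2 * q + a := by
    simp only [Matrix.mulVec_sub, sub_dotProduct, dotProduct_sub, hq2, hq, hw, ha]; ring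
  have c6 : 0 ≤ g - 2 * a + q := by
    rw [← c4]; simpa using hG.posSemidef.dotProduct_mulVec_nonneg (y - u)
  have c7 : g - 2 * a + q ≤ η * (w - 2 * q + a) := by
    have h1 := hup.dotProduct_mulVec_nonneg (y - u)
    simp only [star_trivial, Matrix.sub_mulVec, dotProduct_sub _ (η • A *ᵥ (y - u)),
      Matrix.smul_mulVec, dotProduct_smul, smul_eq_mul, c4, c5] at h1
    linarith
  have hν : nuMeas A G u ^ 2 = (g - 2 * a + q) / a := by
    have e : u ⬝ᵥ ((G - A) * G⁻¹ * (G - A)) *ᵥ u = g - 2 * a + q := by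
      have : (G - A) * G⁻¹ * (G - A) = G - A - A + A * G⁻¹ * A := by
        rw [Matrix.sub_mul, Matrix.mul_nonsing_inv _ hGu, Matrix.sub_mul, Matrix.one_mul,
          Matrix.mul_sub, Matrix.mul_assoc A, Matrix.nonsing_inv_mul _ hGu, Matrix.mul_one]
        abel
      rw [this]
      simp only [Matrix.add_mulVec, Matrix.sub_mulVec, dotProduct_add, dotProduct_sub, ha, hg, hq4]
      ring
    rw [nuMeas, e, ha, Real.sq_sqrt (by positivity)]
  obtain ⟨T, hT⟩ : ∃ T, T = τ * (a / q) + (1 - τ) * (g / a) := ⟨_, rfl⟩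
  have hT0 : 0 < T := by
    have h1 : 0 < a / q := by positivity
    have h2 : 0 < g / a := by positivity
    rcases hτ.1.eq_or_lt with h | h
    · rw [hT, ← h]; simpa using h2
    · have := mul_pos h h1
      have := mul_nonneg (sub_nonneg.mpr hτ.2) h2.le
      rw [hT]; linarith
  obtain ⟨φ, hφ⟩ : ∃ φ, φ = τ * (a / q) / T := ⟨_, rfl⟩
  have hB := aux_broyd A G hAs hGs y u hu hy τ a g q φ ha hg hq4 (by rw [hφ, hT])
  obtain ⟨hCD, hdet⟩ := aux_CD a g q τ T φ ha0.ne' hg0.ne' hq0.ne' hT0.ne' hT hφ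
  have hΓ := aux_gram G y u
  rw [hq3, ha2, ha3, hg] at hΓ
  have hΓA := aux_gram A y u
  rw [hq2, ha, hq, hw] at hΓA
  rw [← hΓ] at hCD hdet
  have hinv := aux_inv G (Matrix.of ![y, u])ᵀ _ _ hGu hCD
  have hdet2 := aux_det G (Matrix.of ![y, u])ᵀ
    !![φ * ((g / a + 1) / a) + (1 - φ) * a⁻¹, - φ * a⁻¹; - φ * a⁻¹, -(1 - φ) * g⁻¹]
  rw [Matrix.transpose_transpose] at hdet2
  rw [hdet, ← Matrix.transpose_transpose (Matrix.of ![y, u])] at hdet2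
  simp only [Matrix.transpose_transpose] at hdet2 hinv hB
  rw [← hB] at hinv hdet2
  have hinv2 := Matrix.inv_eq_right_inv hinv
  have hBu : IsUnit (broyd τ A G u).det := by
    rw [hdet2]; exact (mul_pos hG.det_pos (inv_pos.mpr hT0)).ne'.isUnit
  have htr : ((broyd τ A G u)⁻¹ * A).trace =
      (G⁻¹ * A).trace - (τ * (w / q - 1) + (1 - τ) * (q / a - 1)) := by
    rw [hinv2, Matrix.add_mul, Matrix.trace_add, Matrix.mul_assoc, Matrix.mul_assoc,
      Matrix.trace_mul_comm (Matrix.of ![y, u])ᵀ, Matrix.mul_assoc, hΓA]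
    simp [Matrix.trace, Fin.sum_univ_two, Matrix.mul_apply]
    field_simp
    ring
  have hfin := aux_final a g q w ξ η τ _ ha0 hg0 hq0 hξ hη hτ.1 hτ.2 c1 c2 c3 c6 c7 hν
  rw [← hT] at hfin
  have hd : 0 < (A⁻¹ * G).det := by
    rw [Matrix.det_mul]; exact mul_pos hA.inv.det_pos hG.det_pos
  have hlog : Real.log (A⁻¹ * broyd τ A G u).det = Real.log (A⁻¹ * G).det - Real.log T := by
    rw [Matrix.det_mul, hdet2, ← mul_assoc, ← Matrix.det_mul, ← div_eq_mul_inv,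
      Real.log_div hd.ne' hT0.ne']
  rw [psiBarrier, psiBarrier, hlog, aux_trace _ _ hGu, aux_trace _ _ hBu, htr]
  linarith
end

section
/- In the quadratic quasi-Newton scheme with the BFGS choice τ_k = 0 for all k, assuming L > μ, for every integer k ≥ 4n·ln(L/μ) one has λ_k ≤ ((4n/k)·ln(L/μ))^{k/2} · λ_0. -/
open Matrix Finset

theorem bq_one_le_det {n : ℕ} (M : Matrix (Fin n) (Fin n) ℝ) (h : (M - 1).PosSemidef) :
    1 ≤ M.det := by
  have hM : M.IsHermitian := by
    have := h.isHermitian.add (isHermitian_one (α := ℝ) (n := Fin n))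
    simpa using this
  rw [hM.det_eq_prod_eigenvalues]
  have : ∀ i, 1 ≤ hM.eigenvalues i := by
    intro i
    have h1 := hM.eigenvalues_eq i
    have h2 := h.dotProduct_mulVec_nonneg (⇑(hM.eigenvectorBasis i))
    have h3 : (star ⇑(hM.eigenvectorBasis i)) ⬝ᵥ ⇑(hM.eigenvectorBasis i) = 1 := by
      rw [dotProduct_comm, ← EuclideanSpace.inner_eq_star_dotProduct]
      simp
    rw [sub_mulVec, dotProduct_sub, one_mulVec, h3] at h2
    rw [h1]
    simpa using h2
  calc (1:ℝ) = ∏ i : Fin n, (1:ℝ) := by simp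
    _ ≤ _ := by
      apply Finset.prod_le_prod
      · intros; norm_num
      · intro i _; simpa using this i

open scoped MatrixOrder in
theorem bq_det_mono {n : ℕ} (P Q : Matrix (Fin n) (Fin n) ℝ) (hP : P.PosDef)
    (h : (Q - P).PosSemidef) : P.det ≤ Q.det := by
  obtain ⟨C, hC⟩ := CStarAlgebra.nonneg_iff_eq_star_mul_self.mp hP.posSemidef.nonneg
  rw [Matrix.star_eq_conjTranspose] at hC
  have hd := hP.det_pos
  have hdC : P.det = C.det * C.det := by rw [hC, det_mul, det_conjTranspose]; simp
  have hC0 : C.det ≠ 0 := by intro h0; rw [hdC, h0] at hd; simp at hd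
  have hu : IsUnit C.det := isUnit_iff_ne_zero.mpr hC0
  have h1 := h.conjTranspose_mul_mul_same C⁻¹
  have h2 : (C⁻¹)ᴴ * (Q - P) * C⁻¹ = (C⁻¹)ᴴ * Q * C⁻¹ - 1 := by
    have : (C⁻¹)ᴴ * P * C⁻¹ = 1 := by
      rw [hC, ← Matrix.mul_assoc, ← conjTranspose_mul, Matrix.mul_nonsing_inv _ hu, conjTranspose_one,
        Matrix.one_mul, Matrix.mul_nonsing_inv _ hu]
    rw [Matrix.mul_sub, Matrix.sub_mul, this]
  rw [h2] at h1
  have h3 := bq_one_le_det _ h1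
  have h4 : C.det * C.det * ((C⁻¹)ᴴ * Q * C⁻¹).det = Q.det := by
    rw [det_mul, det_mul, det_conjTranspose, det_nonsing_inv]
    simp
    field_simp
  rw [← h4, hdC]
  have : 0 < C.det * C.det := hdC ▸ hd
  nlinarith

theorem bq_symm {n : ℕ} {M : Matrix (Fin n) (Fin n) ℝ} (h : M.IsHermitian) (v w : Fin n → ℝ) :
    v ⬝ᵥ M.mulVec w = w ⬝ᵥ M.mulVec v := by
  have h' : Mᵀ = M := (conjTranspose_eq_transpose_of_trivial M).symm.trans h
  rw [dotProduct_mulVec, ← mulVec_transpose, h', dotProduct_comm]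

theorem bq_psd {n : ℕ} {M : Matrix (Fin n) (Fin n) ℝ} (h : M.PosSemidef) (v : Fin n → ℝ) :
    0 ≤ v ⬝ᵥ M.mulVec v := by simpa using h.dotProduct_mulVec_nonneg v

/-- the BFGS update -/
noncomputable def bqUp {n : ℕ} (A G : Matrix (Fin n) (Fin n) ℝ) (u : Fin n → ℝ) :
    Matrix (Fin n) (Fin n) ℝ :=
  G - (u ⬝ᵥ G.mulVec u)⁻¹ • (G * vecMulVec u u * G) +
    (u ⬝ᵥ A.mulVec u)⁻¹ • (A * vecMulVec u u * A)

theorem bq_broyd {n : ℕ} (A G : Matrix (Fin n) (Fin n) ℝ) (u : Fin n → ℝ) (hu : u ≠ 0) :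
    broyd 0 A G u = bqUp A G u := by
  simp [broyd, bqUp, hu]

theorem bq_rank_one {n : ℕ} {M : Matrix (Fin n) (Fin n) ℝ} (h : M.IsHermitian) (u : Fin n → ℝ) :
    M * vecMulVec u u * M = vecMulVec (M.mulVec u) (M.mulVec u) := by
  have h' : Mᵀ = M := (conjTranspose_eq_transpose_of_trivial M).symm.trans h
  rw [mul_vecMulVec, vecMulVec_mul, ← mulVec_transpose, h']

theorem bq_up_herm {n : ℕ} {A G : Matrix (Fin n) (Fin n) ℝ} (hA : A.IsHermitian)
    (hG : G.IsHermitian) (u : Fin n → ℝ) : (bqUp A G u).IsHermitian := by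
  have hA' : Aᵀ = A := (conjTranspose_eq_transpose_of_trivial A).symm.trans hA
  have hG' : Gᵀ = G := (conjTranspose_eq_transpose_of_trivial G).symm.trans hG
  unfold bqUp
  rw [bq_rank_one hA, bq_rank_one hG]
  simp [IsHermitian, transpose_vecMulVec, hG']

theorem bq_up_mulVec {n : ℕ} {A G : Matrix (Fin n) (Fin n) ℝ} (hA : A.IsHermitian)
    (hG : G.IsHermitian) (u w v : Fin n → ℝ) :
    w ⬝ᵥ (bqUp A G u).mulVec v = w ⬝ᵥ G.mulVec v
      - (u ⬝ᵥ G.mulVec v) * (u ⬝ᵥ G.mulVec w) / (u ⬝ᵥ G.mulVec u)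
      + (u ⬝ᵥ A.mulVec v) * (u ⬝ᵥ A.mulVec w) / (u ⬝ᵥ A.mulVec u) := by
  unfold bqUp
  rw [bq_rank_one hA, bq_rank_one hG]
  simp only [add_mulVec, sub_mulVec, smul_mulVec, vecMulVec_mulVec, dotProduct_add, dotProduct_sub,
    dotProduct_smul, smul_eq_mul, op_smul_eq_smul]
  rw [dotProduct_comm (G.mulVec u) v, dotProduct_comm (A.mulVec u) v, bq_symm hG v u,
    bq_symm hA v u, bq_symm hG w u, bq_symm hA w u]
  ring

theorem bq_up_det {n : ℕ} {A G : Matrix (Fin n) (Fin n) ℝ} (hA : A.IsHermitian)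
    (hG : G.PosDef) (u : Fin n → ℝ) (ha : u ⬝ᵥ A.mulVec u ≠ 0) (hg : u ⬝ᵥ G.mulVec u ≠ 0) :
    (bqUp A G u).det = G.det * ((u ⬝ᵥ A.mulVec u) / (u ⬝ᵥ G.mulVec u)) := by
  have hu : IsUnit G.det := isUnit_iff_ne_zero.mpr hG.det_pos.ne'
  have e : bqUp A G u = G +
      (Matrix.of fun i (j : Fin 2) => ![-(u ⬝ᵥ G.mulVec u)⁻¹ * (G.mulVec u i),
          (u ⬝ᵥ A.mulVec u)⁻¹ * (A.mulVec u i)] j) *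
      (Matrix.of ![G.mulVec u, A.mulVec u]) := by
    unfold bqUp
    rw [bq_rank_one hA, bq_rank_one hG.isHermitian]
    ext i j
    simp [Matrix.mul_apply, Fin.sum_univ_two, vecMulVec_apply]
    ring
  have e1 : ∀ w v : Fin n → ℝ, (∑ x, (∑ y, w y * G⁻¹ y x) * v x) = w ⬝ᵥ G⁻¹.mulVec v := by
    intro w v
    rw [dotProduct_mulVec]
    simp [dotProduct, vecMul]
  have e2 : G⁻¹.mulVec (G.mulVec u) = u := by
    rw [mulVec_mulVec, nonsing_inv_mul _ hu, one_mulVec]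
  have e3 : ∀ w v : Fin n → ℝ, ∀ c : ℝ, (∑ x, (∑ y, w y * G⁻¹ y x) * (c * v x)) = c * (w ⬝ᵥ G⁻¹.mulVec v) := by
    intro w v c
    rw [← e1, Finset.mul_sum]
    apply Finset.sum_congr rfl; intros; ring
  rw [e, det_add_mul _ _ hu, det_fin_two]
  congr 1
  simp only [Matrix.add_apply, Matrix.mul_apply, Matrix.of_apply, one_apply_eq, Matrix.cons_val_zero,
    Matrix.cons_val_one, e3, e2]
  have q1 : G.mulVec u ⬝ᵥ G⁻¹.mulVec (A.mulVec u) = u ⬝ᵥ A.mulVec u := by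
    rw [bq_symm hG.inv.isHermitian, e2, dotProduct_comm]
  simp [q1, -mulVec_mulVec]
  rw [dotProduct_comm (G.mulVec u), dotProduct_comm (A.mulVec u) u]
  field_simp
  ring

/-- order reversal for inverses, in vector form -/
theorem bq_inv_anti {n : ℕ} {P Q : Matrix (Fin n) (Fin n) ℝ} (hP : P.PosSemidef)
    (h : ∀ v, v ⬝ᵥ P.mulVec v ≤ v ⬝ᵥ Q.mulVec v) (p q : Fin n → ℝ)
    (hpq : P.mulVec p = Q.mulVec q) :
    q ⬝ᵥ Q.mulVec q ≤ p ⬝ᵥ P.mulVec p := by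
  have h1 := bq_psd hP (p - q)
  have h2 := h q
  simp only [mulVec_sub, dotProduct_sub, sub_dotProduct] at h1
  rw [bq_symm hP.isHermitian p q, hpq] at h1
  have h3 : p ⬝ᵥ Q.mulVec q = p ⬝ᵥ P.mulVec p := by rw [hpq]
  linarith

/-- Step: lower bound. -/
theorem bq_up_ge {n : ℕ} {A G : Matrix (Fin n) (Fin n) ℝ} (hA : A.PosDef)
    (hG : G.IsHermitian) (u : Fin n → ℝ) (hu : u ≠ 0)
    (h : ∀ v, v ⬝ᵥ A.mulVec v ≤ v ⬝ᵥ G.mulVec v) (v : Fin n → ℝ) :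
    v ⬝ᵥ A.mulVec v ≤ v ⬝ᵥ (bqUp A G u).mulVec v := by
  rw [bq_up_mulVec hA.isHermitian hG]
  have ha : 0 < u ⬝ᵥ A.mulVec u := by simpa using hA.dotProduct_mulVec_pos hu
  have hg : 0 < u ⬝ᵥ G.mulVec u := lt_of_lt_of_le ha (h u)
  set a := u ⬝ᵥ A.mulVec u with hadef
  set g := u ⬝ᵥ G.mulVec u with hgdef
  have h1 := h (v - ((u ⬝ᵥ G.mulVec v) / g) • u)
  simp only [mulVec_sub, dotProduct_sub, sub_dotProduct, mulVec_smul, dotProduct_smul,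
    smul_dotProduct, smul_eq_mul] at h1
  rw [bq_symm hA.isHermitian v u, bq_symm hG v u, ← hadef, ← hgdef] at h1
  set s := u ⬝ᵥ G.mulVec v
  set r := u ⬝ᵥ A.mulVec v
  have h2 : s / g * s - s / g * (s / g * g) = 0 := by field_simp; ring
  have h3 : 0 ≤ r * r / a - 2 * (s/g) * r + (s/g)^2 * a := by
    have : r * r / a - 2 * (s/g) * r + (s/g)^2 * a = (r - (s/g)*a)^2 / a := by field_simp; ring
    rw [this]; positivity
  have h4 : s * s / g = s / g * s := by ring
  rw [h4]
  nlinarith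

/-- Step: upper bound. -/
theorem bq_up_le {n : ℕ} {A G : Matrix (Fin n) (Fin n) ℝ} (hA : A.PosDef)
    (hG : G.PosDef) (u : Fin n → ℝ) (hu : u ≠ 0) (η : ℝ) (hη : 1 ≤ η)
    (h : ∀ v, v ⬝ᵥ G.mulVec v ≤ η * (v ⬝ᵥ A.mulVec v)) (v : Fin n → ℝ) :
    v ⬝ᵥ (bqUp A G u).mulVec v ≤ η * (v ⬝ᵥ A.mulVec v) := by
  rw [bq_up_mulVec hA.isHermitian hG.isHermitian]
  have ha : 0 < u ⬝ᵥ A.mulVec u := by simpa using hA.dotProduct_mulVec_pos hu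
  have hg : 0 < u ⬝ᵥ G.mulVec u := by simpa using hG.dotProduct_mulVec_pos hu
  set a := u ⬝ᵥ A.mulVec u with hadef
  set g := u ⬝ᵥ G.mulVec u with hgdef
  have h1 := h (v - ((u ⬝ᵥ A.mulVec v) / a) • u)
  simp only [mulVec_sub, dotProduct_sub, sub_dotProduct, mulVec_smul, dotProduct_smul,
    smul_dotProduct, smul_eq_mul] at h1
  rw [bq_symm hA.isHermitian v u, bq_symm hG.isHermitian v u, ← hadef, ← hgdef] at h1
  set s := u ⬝ᵥ G.mulVec v
  set r := u ⬝ᵥ A.mulVec v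
  have h2 : r / a * r - r / a * (r / a * a) = 0 := by field_simp; ring
  have h3 : 0 ≤ s * s / g - 2 * (r/a) * s + (r/a)^2 * g := by
    have : s * s / g - 2 * (r/a) * s + (r/a)^2 * g = (s - (r/a)*g)^2 / g := by field_simp; ring
    rw [this]; positivity
  have h4 : r * r / a = r / a * r := by ring
  have h5 : 0 ≤ r / a * r := by rw [← h4]; exact div_nonneg (mul_self_nonneg _) ha.le
  rw [h4]
  nlinarith

/-- Step: contraction of the local norm. -/
theorem bq_up_contr {n : ℕ} {A G : Matrix (Fin n) (Fin n) ℝ} (hA : A.PosDef)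
    (hG : G.IsHermitian) (u : Fin n → ℝ) (hu : u ≠ 0)
    (h : ∀ v, v ⬝ᵥ A.mulVec v ≤ v ⬝ᵥ G.mulVec v) (w : Fin n → ℝ)
    (hw : (bqUp A G u).mulVec w = G.mulVec u - A.mulVec u) :
    w ⬝ᵥ (bqUp A G u).mulVec w ≤
      2 * ((u ⬝ᵥ G.mulVec u) / (u ⬝ᵥ A.mulVec u) - 1) * (u ⬝ᵥ G.mulVec u) := by
  have ha : 0 < u ⬝ᵥ A.mulVec u := by simpa using hA.dotProduct_mulVec_pos hu
  have hag := h u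
  have e1 := bq_up_mulVec hA.isHermitian hG u u w
  have e2 := bq_up_mulVec hA.isHermitian hG u w w
  rw [hw] at e1 e2 ⊢
  simp only [dotProduct_sub] at e1 e2 ⊢
  set a := u ⬝ᵥ A.mulVec u with hadef
  set g := u ⬝ᵥ G.mulVec u with hgdef
  have hg : 0 < g := lt_of_lt_of_le ha hag
  -- z = w - c u with c = (g-a)/a
  set c := (g - a) / a with hc
  have hwA : u ⬝ᵥ A.mulVec w = g - a := by
    field_simp at e1
    linarith
  obtain ⟨z, hz⟩ : ∃ z, z = w - c • u := ⟨_, rfl⟩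
  have hwz : w = z + c • u := by rw [hz]; simp
  have hzA : u ⬝ᵥ A.mulVec z = 0 := by
    rw [hz, mulVec_sub, dotProduct_sub, hwA, mulVec_smul, dotProduct_smul, ← hadef, smul_eq_mul, hc]
    field_simp; ring
  -- Cauchy-Schwarz for G - A
  have cs : ∀ t : ℝ, 0 ≤ (z ⬝ᵥ G.mulVec z) - 2 * t * (u ⬝ᵥ G.mulVec z) + t^2 * (g - a) := by
    intro t
    have h1 := h (z - t • u)
    simp only [mulVec_sub, dotProduct_sub, sub_dotProduct, mulVec_smul, dotProduct_smul,
      smul_dotProduct, smul_eq_mul] at h1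
    rw [bq_symm hA.isHermitian z u, bq_symm hG z u, ← hadef, ← hgdef, hzA] at h1
    have := bq_psd hA.posSemidef z
    nlinarith
  rw [hwA, bq_symm hA.isHermitian w u, hwA, bq_symm hG w u] at e2
  rw [bq_symm hA.isHermitian w u, hwA, bq_symm hG w u]
  have eG : u ⬝ᵥ G.mulVec w = u ⬝ᵥ G.mulVec z + c * g := by
    rw [hwz]; simp [mulVec_add, mulVec_smul, ← hgdef]
  have eGw : w ⬝ᵥ G.mulVec w = z ⬝ᵥ G.mulVec z + 2 * c * (u ⬝ᵥ G.mulVec z) + c^2 * g := by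
    rw [hwz]; simp [mulVec_add, mulVec_smul, ← hgdef, bq_symm hG z u]; ring
  rw [eGw, eG] at e2
  rw [eG]
  set p := u ⬝ᵥ G.mulVec z
  set Z := z ⬝ᵥ G.mulVec z
  have ec : c * a = g - a := by rw [hc]; field_simp
  have hc0 : 0 ≤ c := by rw [hc]; apply div_nonneg; linarith; exact ha.le
  have ega : g / a - 1 = c := by rw [hc]; field_simp
  rw [ega]
  have eg : g = (c + 1) * a := by linarith
  have ep : Z = p + p^2 / g := by
    have t1 : (p + c*g) * (p + c * g) / g = p^2/g + 2 * c * p + c^2 * g := by field_simp; ring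
    have t2 : (g - a) * (g - a) / a = c * (g - a) := by rw [hc]; field_simp
    rw [t1, t2] at e2
    nlinarith
  have key : p ≤ c * g := by
    by_contra hcon
    push Not at hcon
    have hp : 0 < p := lt_of_le_of_lt (by positivity) hcon
    have hZ : 0 < Z := by rw [ep]; positivity
    have h1 := cs (Z / p)
    have h2 : p ^ 2 ≤ Z * (c * a) := by
      have e : Z - 2 * (Z / p) * p + (Z / p)^2 * (g - a) = (Z / p^2) * (Z * (c * a) - p^2) := by
        rw [ec]; field_simp; ring
      rw [e] at h1
      have := nonneg_of_mul_nonneg_right h1 (by positivity)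
      linarith
    have h3 : p * (p * g) ≤ p * ((g + p) * (c * a)) := by
      have e : Z * g = p * (g + p) := by rw [ep]; field_simp
      calc p * (p * g) = p^2 * g := by ring
        _ ≤ Z * (c * a) * g := by gcongr
        _ = (Z * g) * (c * a) := by ring
        _ = _ := by rw [e]; ring
    have h4 := le_of_mul_le_mul_left h3 hp
    have h5 : a * p ≤ a * (c * g) := by
      rw [ec] at h4
      nlinarith
    have h6 := le_of_mul_le_mul_left h5 ha
    linarith
  linarith

theorem bq_amgm (k : ℕ) (hk : 0 < k) (z : ℕ → ℝ) (hz : ∀ i, 0 ≤ z i) :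
    ∏ i ∈ range k, z i ≤ ((∑ i ∈ range k, z i) / k) ^ k := by
  have hk' : (0:ℝ) < k := by exact_mod_cast hk
  have h := Real.geom_mean_le_arith_mean_weighted (range k) (fun _ => (1 / k : ℝ)) z
    (fun _ _ => by positivity) (by simp; field_simp) (fun i _ => hz i)
  have h2 := pow_le_pow_left₀ (Finset.prod_nonneg fun i _ => Real.rpow_nonneg (hz i) _) h k
  rw [← Finset.prod_pow, ← Finset.mul_sum] at h2
  have e : ∀ i ∈ range k, (z i ^ (1 / k : ℝ)) ^ k = z i := by
    intro i _
    rw [one_div, Real.rpow_inv_natCast_pow (hz i) hk.ne']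
  rw [Finset.prod_congr rfl e] at h2
  calc _ ≤ _ := h2
    _ = _ := by congr 1; ring

theorem bq_final (n k : ℕ) (hn : 1 ≤ n) (κ : ℝ) (hκ : 1 < κ)
    (hk : 4 * n * Real.log κ ≤ (k : ℝ)) (r : ℕ → ℝ) (hr : ∀ i, 1 ≤ r i)
    (hprod : ∏ i ∈ range k, r i ≤ κ ^ n) :
    κ * ∏ i ∈ range k, (2 * (r i - 1)) ≤ ((4 * n / k : ℝ) * Real.log κ) ^ k := by
  have hl : 0 < Real.log κ := Real.log_pos hκ
  have hn' : (1:ℝ) ≤ n := by exact_mod_cast hn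
  have hk' : (0:ℝ) < k := lt_of_lt_of_le (by positivity) hk
  have hk0 : 0 < k := by exact_mod_cast hk'
  have hκ0 : 0 < κ := by linarith
  have hlr : ∀ i, 0 ≤ Real.log (r i) := fun i => Real.log_nonneg (hr i)
  have h1 : ∏ i ∈ range k, (2 * (r i - 1)) ≤ ∏ i ∈ range k, (2 * (r i * Real.log (r i))) := by
    apply Finset.prod_le_prod
    · intro i _; have := hr i; linarith
    · intro i _
      have h0 : 0 < r i := by have := hr i; linarith
      have h := Real.one_sub_inv_le_log_of_pos h0
      have := mul_le_mul_of_nonneg_left h h0.le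
      rw [mul_sub, mul_inv_cancel₀ h0.ne'] at this
      linarith
  have h2 : ∏ i ∈ range k, (2 * (r i * Real.log (r i))) =
      2 ^ k * ((∏ i ∈ range k, r i) * ∏ i ∈ range k, Real.log (r i)) := by
    rw [Finset.prod_mul_distrib, Finset.prod_mul_distrib]; simp
  have hsum : ∑ i ∈ range k, Real.log (r i) ≤ n * Real.log κ := by
    rw [← Real.log_prod (fun i _ => by have := hr i; positivity), ← Real.log_pow]
    apply Real.log_le_log _ hprod
    exact Finset.prod_pos fun i _ => by have := hr i; linarith
  have hS0 : 0 ≤ ∑ i ∈ range k, Real.log (r i) := Finset.sum_nonneg fun i _ => hlr i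
  have h3 : ∏ i ∈ range k, Real.log (r i) ≤ (n * Real.log κ / k) ^ k := by
    refine (bq_amgm k hk0 _ hlr).trans ?_
    gcongr
  have h4 : κ ^ (n + 1) ≤ 2 ^ k := by
    rw [← Real.log_le_log_iff (by positivity) (by positivity), Real.log_pow, Real.log_pow]
    have := Real.log_two_gt_d9
    push_cast
    nlinarith
  calc κ * ∏ i ∈ range k, (2 * (r i - 1))
      ≤ κ * (2 ^ k * ((∏ i ∈ range k, r i) * ∏ i ∈ range k, Real.log (r i))) := by
        rw [← h2]; gcongr
    _ ≤ κ * (2 ^ k * (κ ^ n * (n * Real.log κ / k) ^ k)) := by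
        gcongr
        exact Finset.prod_nonneg fun i _ => hlr i
    _ = κ ^ (n + 1) * (2 ^ k * (n * Real.log κ / k) ^ k) := by ring
    _ ≤ 2 ^ k * (2 ^ k * (n * Real.log κ / k) ^ k) := by gcongr
    _ = _ := by rw [← mul_pow, ← mul_pow]; congr 1; ring

theorem quad_scheme_bfgs_superlinear {n : ℕ} (hn : 1 ≤ n)
    (B A : Matrix (Fin n) (Fin n) ℝ) (hB : B.PosDef) (hA : A.PosDef)
    (μ L : ℝ) (hμ : 0 < μ) (hL : 0 < L)
    (hμB : psdLE (μ • B) A) (hLB : psdLE A (L • B))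
    (b : Fin n → ℝ) (τ : ℕ → ℝ) (hτ : ∀ k, τ k ∈ Set.Icc (0 : ℝ) 1)
    (x : ℕ → Fin n → ℝ) (G : ℕ → Matrix (Fin n) (Fin n) ℝ)
    (hG0 : G 0 = L • B)
    (hx : ∀ k, x (k + 1) = x k - (G k)⁻¹.mulVec (A.mulVec (x k) - b))
    (hGrec : ∀ k, G (k + 1) = broyd (τ k) A (G k) (x (k + 1) - x k))
    (lam : ℕ → ℝ)
    (hlam : ∀ k, lam k =
      Real.sqrt ((A.mulVec (x k) - b) ⬝ᵥ A⁻¹.mulVec (A.mulVec (x k) - b)))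
    (hτ0 : ∀ k, τ k = 0) (hLμ : μ < L)
    (k : ℕ) (hk : 4 * n * Real.log (L / μ) ≤ (k : ℝ)) :
    lam k ≤ ((4 * n / k : ℝ) * Real.log (L / μ)) ^ ((k : ℝ) / 2) * lam 0 := by
  set κ := L / μ with hκd
  have hκ : 1 < κ := by rw [hκd, lt_div_iff₀ hμ]; linarith
  have hκ0 : 0 < κ := by linarith
  have hAh := hA.isHermitian
  have hPD : ∀ M : Matrix (Fin n) (Fin n) ℝ, M.IsHermitian →
      (∀ v, v ⬝ᵥ A.mulVec v ≤ v ⬝ᵥ M.mulVec v) → M.PosDef := by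
    intro M hM h
    apply PosDef.of_dotProduct_mulVec_pos hM
    intro v hv
    have h1 : 0 < v ⬝ᵥ A.mulVec v := by simpa using hA.dotProduct_mulVec_pos hv
    simpa using lt_of_lt_of_le h1 (h v)
  -- invariants
  have inv : ∀ i, (G i).IsHermitian ∧ (∀ v, v ⬝ᵥ A.mulVec v ≤ v ⬝ᵥ (G i).mulVec v) ∧
      (∀ v, v ⬝ᵥ (G i).mulVec v ≤ κ * (v ⬝ᵥ A.mulVec v)) := by
    intro i
    induction i with
    | zero =>
      rw [hG0]
      refine ⟨(hB.smul hL).isHermitian, fun v => ?_, fun v => ?_⟩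
      · have := bq_psd hLB v
        rw [sub_mulVec, dotProduct_sub] at this
        linarith
      · have := bq_psd hμB v
        rw [sub_mulVec, dotProduct_sub, smul_mulVec, dotProduct_smul, smul_eq_mul] at this
        rw [smul_mulVec, dotProduct_smul, smul_eq_mul, hκd, div_mul_eq_mul_div, le_div_iff₀ hμ]
        nlinarith
    | succ i ih =>
      obtain ⟨h1, h2, h3⟩ := ih
      rw [hGrec, hτ0]
      by_cases hu : x (i + 1) - x i = 0
      · rw [broyd, if_pos hu]; exact ⟨h1, h2, h3⟩
      · rw [bq_broyd _ _ _ hu]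
        exact ⟨bq_up_herm hAh h1 _, bq_up_ge hA h1 _ hu h2,
          bq_up_le hA (hPD _ h1 h2) _ hu κ hκ.le h3⟩
  have hGpd : ∀ i, (G i).PosDef := fun i => hPD _ (inv i).1 (inv i).2.1
  have hdet : ∀ i, 0 < (G i).det := fun i => (hGpd i).det_pos
  obtain ⟨u, hu⟩ : ∃ u : ℕ → Fin n → ℝ, ∀ i, u i = x (i + 1) - x i := ⟨_, fun _ => rfl⟩
  have hGu : ∀ i, (G i).mulVec (u i) = -(A.mulVec (x i) - b) := by
    intro i
    have : IsUnit (G i).det := isUnit_iff_ne_zero.mpr (hdet i).ne'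
    rw [hu, hx]
    rw [show x i - (G i)⁻¹.mulVec (A.mulVec (x i) - b) - x i
      = -((G i)⁻¹.mulVec (A.mulVec (x i) - b)) by abel]
    rw [mulVec_neg, mulVec_mulVec, mul_nonsing_inv _ this, one_mulVec]
  have hgrad : ∀ i, A.mulVec (x (i + 1)) - b = (A.mulVec (x i) - b) + A.mulVec (u i) := by
    intro i
    rw [hu, mulVec_sub]; abel
  obtain ⟨m, hm⟩ : ∃ m : ℕ → ℝ, ∀ i, m i = u i ⬝ᵥ (G i).mulVec (u i) := ⟨_, fun _ => rfl⟩
  have hm0 : ∀ i, 0 ≤ m i := fun i => by rw [hm]; exact bq_psd (hGpd i).posSemidef _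
  obtain ⟨r, hr⟩ : ∃ r : ℕ → ℝ, ∀ i, r i = (G i).det / (G (i + 1)).det := ⟨_, fun _ => rfl⟩
  have step : ∀ i, 1 ≤ r i ∧ m (i + 1) ≤ 2 * (r i - 1) * m i := by
    intro i
    by_cases h0 : u i = 0
    · have hGe : G (i + 1) = G i := by rw [hGrec, ← hu, h0, broyd, if_pos rfl]
      have hr1 : r i = 1 := by rw [hr, hGe, div_self (hdet i).ne']
      refine ⟨hr1.ge, ?_⟩
      have h1 : A.mulVec (x i) - b = 0 := by
        have := hGu i
        rw [h0, mulVec_zero] at this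
        exact neg_eq_zero.mp this.symm
      have h2 := hGu (i + 1)
      rw [hgrad, h1, h0] at h2
      rw [hm (i + 1), h2, hr1]
      simp
    · have hGe : G (i + 1) = bqUp A (G i) (u i) := by
        rw [hGrec, ← hu, hτ0, bq_broyd _ _ _ h0]
      have ha : 0 < u i ⬝ᵥ A.mulVec (u i) := by simpa using hA.dotProduct_mulVec_pos h0
      have hag := (inv i).2.1 (u i)
      have hg := lt_of_lt_of_le ha hag
      have hr1 : r i = (u i ⬝ᵥ (G i).mulVec (u i)) / (u i ⬝ᵥ A.mulVec (u i)) := by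
        rw [hr, hGe, bq_up_det hAh (hGpd i) _ ha.ne' hg.ne']
        have := (hdet i).ne'
        field_simp
      refine ⟨by rw [hr1, one_le_div ha]; exact hag, ?_⟩
      have h2 := hGu (i + 1)
      have h3 : (G (i + 1)).mulVec (u (i + 1)) = (G i).mulVec (u i) - A.mulVec (u i) := by
        rw [h2, hgrad, hGu i]; abel
      rw [hm (i + 1), hm i, hr1]
      rw [hGe] at h3 ⊢
      exact bq_up_contr hA (inv i).1 _ h0 (inv i).2.1 _ h3
  have hmk : ∀ j, m j ≤ (∏ i ∈ range j, (2 * (r i - 1))) * m 0 := by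
    intro j
    induction j with
    | zero => simp
    | succ j ih =>
      rw [Finset.prod_range_succ]
      have h1 := (step j).1
      calc m (j + 1) ≤ 2 * (r j - 1) * m j := (step j).2
        _ ≤ 2 * (r j - 1) * ((∏ i ∈ range j, (2 * (r i - 1))) * m 0) :=
          mul_le_mul_of_nonneg_left ih (by linarith)
        _ = _ := by ring
  have htel : ∀ j, ∏ i ∈ range j, r i = (G 0).det / (G j).det := by
    intro j
    induction j with
    | zero => simp [(hdet 0).ne']
    | succ j ih =>
      rw [Finset.prod_range_succ, ih, hr]
      have := (hdet j).ne'
      have := (hdet (j + 1)).ne'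
      field_simp
  have hprod : ∏ i ∈ range k, r i ≤ κ ^ n := by
    rw [htel, div_le_iff₀ (hdet k)]
    have d1 : (G 0).det ≤ κ ^ n * A.det := by
      have h1 : (κ • A - G 0).PosSemidef := by
        apply PosSemidef.of_dotProduct_mulVec_nonneg
        · exact (hA.smul hκ0).isHermitian.sub (inv 0).1
        · intro v
          have := (inv 0).2.2 v
          simp only [star_trivial, sub_mulVec, dotProduct_sub, smul_mulVec, dotProduct_smul,
            smul_eq_mul]
          linarith
      have := bq_det_mono _ _ (hGpd 0) h1
      rwa [det_smul, Fintype.card_fin] at this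
    have d2 : A.det ≤ (G k).det := by
      apply bq_det_mono _ _ hA
      apply PosSemidef.of_dotProduct_mulVec_nonneg
      · exact (inv k).1.sub hAh
      · intro v
        have := (inv k).2.1 v
        simp only [star_trivial, sub_mulVec, dotProduct_sub]
        linarith
    exact d1.trans (mul_le_mul_of_nonneg_left d2 (by positivity))
  have hfin := bq_final n k hn κ hκ hk r (fun i => (step i).1) hprod
  -- comparison of local norms
  have hAu : IsUnit A.det := isUnit_iff_ne_zero.mpr hA.det_pos.ne'
  obtain ⟨q, hq⟩ : ∃ q : ℕ → Fin n → ℝ, ∀ i, q i = -(A⁻¹.mulVec (A.mulVec (x i) - b)) :=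
    ⟨_, fun _ => rfl⟩
  have hAq : ∀ i, A.mulVec (q i) = -(A.mulVec (x i) - b) := by
    intro i
    rw [hq, mulVec_neg, mulVec_mulVec, mul_nonsing_inv _ hAu, one_mulVec]
  have hlamq : ∀ i, lam i = Real.sqrt (q i ⬝ᵥ A.mulVec (q i)) := by
    intro i
    rw [hlam, hAq, hq, neg_dotProduct_neg, dotProduct_comm]
  have hlow : m 0 ≤ q 0 ⬝ᵥ A.mulVec (q 0) := by
    rw [hm]
    exact bq_inv_anti hA.posSemidef (inv 0).2.1 _ _ ((hAq 0).trans (hGu 0).symm)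
  have hup : q k ⬝ᵥ A.mulVec (q k) ≤ κ * m k := by
    have h1 := bq_inv_anti (P := G k) (Q := κ • A) (hGpd k).posSemidef
      (fun v => by
        have := (inv k).2.2 v
        rwa [smul_mulVec, dotProduct_smul, smul_eq_mul]) (u k) (κ⁻¹ • q k)
      (by rw [smul_mulVec, mulVec_smul, smul_smul, mul_inv_cancel₀ hκ0.ne', one_smul, hAq, hGu])
    rw [smul_mulVec, mulVec_smul, smul_smul, mul_inv_cancel₀ hκ0.ne', one_smul, smul_dotProduct,
      smul_eq_mul, ← hm, inv_mul_le_iff₀ hκ0] at h1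
    exact h1
  set c := (4 * n / k : ℝ) * Real.log κ with hc
  have hc0 : 0 ≤ c := by have := Real.log_pos hκ; positivity
  have hP0 : 0 ≤ ∏ i ∈ range k, (2 * (r i - 1)) :=
    Finset.prod_nonneg fun i _ => by have := (step i).1; linarith
  have hmain : q k ⬝ᵥ A.mulVec (q k) ≤ c ^ k * (q 0 ⬝ᵥ A.mulVec (q 0)) := by
    calc _ ≤ κ * m k := hup
      _ ≤ κ * ((∏ i ∈ range k, (2 * (r i - 1))) * m 0) := by gcongr; exact hmk k
      _ = (κ * ∏ i ∈ range k, (2 * (r i - 1))) * m 0 := by ring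
      _ ≤ c ^ k * (q 0 ⬝ᵥ A.mulVec (q 0)) :=
        mul_le_mul hfin hlow (hm0 0) (by positivity)
  rw [hlamq, hlamq]
  have e : c ^ ((k : ℝ) / 2) = Real.sqrt (c ^ k) := by
    rw [Real.sqrt_eq_rpow, ← Real.rpow_natCast, ← Real.rpow_mul hc0]
    congr 1; ring
  rw [e, ← Real.sqrt_mul (by positivity)]
  exact Real.sqrt_le_sqrt hmain
end

section
/- In the quadratic quasi-Newton scheme with the DFP choice τ_k = 1 for all k, assuming L > μ, for every integer k ≥ (4nL/μ)·ln(L/μ) one has λ_k ≤ ((4nL/(μk))·ln(L/μ))^{k/2} · λ_0. -/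
open Matrix Finset

open scoped MatrixOrder in
lemma aux_trace_nonneg {n : ℕ} (P M : Matrix (Fin n) (Fin n) ℝ) (hP : P.PosSemidef)
    (hM : M.PosSemidef) : 0 ≤ (P * M).trace := by
  obtain ⟨R, hR⟩ := CStarAlgebra.nonneg_iff_eq_star_mul_self.1 hP.nonneg
  have h := (hM.mul_mul_conjTranspose_same R).trace_nonneg
  rw [hR, Matrix.mul_assoc, Matrix.trace_mul_comm]
  exact h

lemma aux_symm_s18 {n : ℕ} {A : Matrix (Fin n) (Fin n) ℝ} (hA : A.IsHermitian) (v w : Fin n → ℝ) :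
    v ⬝ᵥ A *ᵥ w = w ⬝ᵥ A *ᵥ v := by
  have h : Aᵀ = A := by simpa [Matrix.IsHermitian] using hA
  rw [Matrix.dotProduct_mulVec, dotProduct_comm]
  congr 1
  rw [← Matrix.vecMul_transpose, h]

lemma aux_vecMul {n : ℕ} {A : Matrix (Fin n) (Fin n) ℝ} (hA : A.IsHermitian) (v : Fin n → ℝ) :
    v ᵥ* A = A *ᵥ v := by
  have h : Aᵀ = A := by simpa [Matrix.IsHermitian] using hA
  rw [← Matrix.vecMul_transpose, h]

lemma broyd_one {n : ℕ} (A G : Matrix (Fin n) (Fin n) ℝ) (hA : A.PosDef) (hG : G.PosDef)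
    (u : Fin n → ℝ) (hu : u ≠ 0) :
    broyd 1 A G u = G - (u ⬝ᵥ A *ᵥ u)⁻¹ • (vecMulVec (A *ᵥ u) (G *ᵥ u) + vecMulVec (G *ᵥ u) (A *ᵥ u))
      + (((u ⬝ᵥ G *ᵥ u) / (u ⬝ᵥ A *ᵥ u) + 1) / (u ⬝ᵥ A *ᵥ u)) • vecMulVec (A *ᵥ u) (A *ᵥ u) := by
  have ha : 0 < u ⬝ᵥ A *ᵥ u := by simpa using hA.dotProduct_mulVec_pos hu
  have hAu : A *ᵥ u ≠ 0 := by
    intro h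
    rw [h] at ha
    simp at ha
  have h1 : 0 < u ⬝ᵥ (A * G⁻¹ * A) *ᵥ u := by
    have h2 : 0 < (A *ᵥ u) ⬝ᵥ G⁻¹ *ᵥ (A *ᵥ u) := by
      simpa using hG.inv.dotProduct_mulVec_pos hAu
    have h3 : u ⬝ᵥ (A * G⁻¹ * A) *ᵥ u = (A *ᵥ u) ⬝ᵥ G⁻¹ *ᵥ (A *ᵥ u) := by
      rw [← Matrix.mulVec_mulVec, ← Matrix.mulVec_mulVec, Matrix.dotProduct_mulVec,
        aux_vecMul hA.1]
    rw [h3]; exact h2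
  have h4 : (u ⬝ᵥ A *ᵥ u) / (u ⬝ᵥ (A * G⁻¹ * A) *ᵥ u) ≠ 0 := (div_pos ha h1).ne'
  simp only [broyd, if_neg hu, one_mul, sub_self, zero_mul, add_zero, div_self h4, one_smul,
    zero_smul, Matrix.mul_vecMulVec, Matrix.vecMulVec_mul, aux_vecMul hA.1, aux_vecMul hG.1]

/-- bilinear form of the DFP update -/
lemma broyd_bilin {n : ℕ} (A G : Matrix (Fin n) (Fin n) ℝ) (hA : A.PosDef) (hG : G.PosDef)
    (u : Fin n → ℝ) (hu : u ≠ 0) (w v : Fin n → ℝ) :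
    w ⬝ᵥ (broyd 1 A G u) *ᵥ v = w ⬝ᵥ G *ᵥ v
      - (u ⬝ᵥ A *ᵥ u)⁻¹ * ((u ⬝ᵥ A *ᵥ w) * (u ⬝ᵥ G *ᵥ v) + (u ⬝ᵥ G *ᵥ w) * (u ⬝ᵥ A *ᵥ v))
      + (((u ⬝ᵥ G *ᵥ u) / (u ⬝ᵥ A *ᵥ u) + 1) / (u ⬝ᵥ A *ᵥ u))
        * ((u ⬝ᵥ A *ᵥ w) * (u ⬝ᵥ A *ᵥ v)) := by
  have e : ∀ (M : Matrix (Fin n) (Fin n) ℝ), M.IsHermitian → ∀ z, (M *ᵥ u) ⬝ᵥ z = u ⬝ᵥ M *ᵥ z := by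
    intro M hM z
    rw [dotProduct_comm, aux_symm_s18 hM]
  rw [broyd_one A G hA hG u hu]
  simp only [Matrix.add_mulVec, Matrix.sub_mulVec, Matrix.smul_mulVec, Matrix.vecMulVec_mulVec,
    dotProduct_add, dotProduct_sub, dotProduct_smul, op_smul_eq_smul, smul_eq_mul,
    e A hA.1, e G hG.1]
  rw [aux_symm_s18 hA.1 w u, aux_symm_s18 hG.1 w u]
  ring

lemma broyd_herm {n : ℕ} (A G : Matrix (Fin n) (Fin n) ℝ) (hA : A.PosDef) (hG : G.PosDef)
    (u : Fin n → ℝ) (hu : u ≠ 0) : (broyd 1 A G u).IsHermitian := by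
  have h : Gᵀ = G := by simpa [Matrix.IsHermitian] using hG.1
  rw [broyd_one A G hA hG u hu]
  simp only [Matrix.IsHermitian, Matrix.conjTranspose_eq_transpose_of_trivial,
    Matrix.transpose_add, Matrix.transpose_sub, Matrix.transpose_smul, Matrix.transpose_vecMulVec, h]
  rw [add_comm (vecMulVec (G *ᵥ u) (A *ᵥ u))]

lemma broyd_trace {n : ℕ} (A G : Matrix (Fin n) (Fin n) ℝ) (hA : A.PosDef) (hG : G.PosDef)
    (u : Fin n → ℝ) (hu : u ≠ 0) :
    (A⁻¹ * broyd 1 A G u).trace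
      = (A⁻¹ * G).trace - ((u ⬝ᵥ G *ᵥ u) / (u ⬝ᵥ A *ᵥ u) - 1) := by
  have ha : 0 < u ⬝ᵥ A *ᵥ u := by simpa using hA.dotProduct_mulVec_pos hu
  have hi : A⁻¹ * A = 1 := Matrix.nonsing_inv_mul _ hA.det_pos.ne'.isUnit
  have hi2 : A * A⁻¹ = 1 := Matrix.mul_nonsing_inv _ hA.det_pos.ne'.isUnit
  have e1 : A⁻¹ *ᵥ (A *ᵥ u) = u := by rw [Matrix.mulVec_mulVec, hi, Matrix.one_mulVec]
  have e2 : (A⁻¹ *ᵥ (G *ᵥ u)) ⬝ᵥ (A *ᵥ u) = u ⬝ᵥ G *ᵥ u := by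
    rw [aux_symm_s18 hA.1, Matrix.mulVec_mulVec, hi2, Matrix.one_mulVec]
  rw [broyd_one A G hA hG u hu]
  simp only [Matrix.mul_add, Matrix.mul_sub, Matrix.mul_smul, Matrix.trace_add, Matrix.trace_sub,
    Matrix.trace_smul, Matrix.mul_vecMulVec, Matrix.trace_vecMulVec, e1, e2, smul_eq_mul]
  field_simp
  ring

lemma posDef_of_ge {n : ℕ} (A G : Matrix (Fin n) (Fin n) ℝ) (hA : A.PosDef) (hG : G.IsHermitian)
    (h : ∀ v, v ⬝ᵥ A *ᵥ v ≤ v ⬝ᵥ G *ᵥ v) : G.PosDef := by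
  refine Matrix.PosDef.of_dotProduct_mulVec_pos hG fun v hv => ?_
  have := hA.dotProduct_mulVec_pos hv
  simp only [star_trivial] at this ⊢
  exact this.trans_le (h v)

/-- the quadratic-form invariant -/
def QInv {n : ℕ} (η : ℝ) (A G : Matrix (Fin n) (Fin n) ℝ) : Prop :=
  G.IsHermitian ∧ (∀ v, v ⬝ᵥ A *ᵥ v ≤ v ⬝ᵥ G *ᵥ v) ∧ (∀ v, v ⬝ᵥ G *ᵥ v ≤ η * (v ⬝ᵥ A *ᵥ v))

lemma quad_proj {n : ℕ} (M : Matrix (Fin n) (Fin n) ℝ) (hM : M.IsHermitian)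
    (u v : Fin n → ℝ) (c : ℝ) :
    (v - c • u) ⬝ᵥ M *ᵥ (v - c • u)
      = v ⬝ᵥ M *ᵥ v - 2 * c * (u ⬝ᵥ M *ᵥ v) + c ^ 2 * (u ⬝ᵥ M *ᵥ u) := by
  simp only [Matrix.mulVec_sub, Matrix.mulVec_smul, dotProduct_sub, sub_dotProduct,
    smul_dotProduct, dotProduct_smul, smul_eq_mul]
  rw [aux_symm_s18 hM v u]
  ring

lemma QInv_step {n : ℕ} (η : ℝ) (hη : 1 ≤ η) (A G : Matrix (Fin n) (Fin n) ℝ) (hA : A.PosDef)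
    (h : QInv η A G) (u : Fin n → ℝ) : QInv η A (broyd 1 A G u) := by
  by_cases hu : u = 0
  · simpa [broyd, hu] using h
  have hG := posDef_of_ge A G hA h.1 h.2.1
  have ha : 0 < u ⬝ᵥ A *ᵥ u := by simpa using hA.dotProduct_mulVec_pos hu
  have key : ∀ v, v ⬝ᵥ (broyd 1 A G u) *ᵥ v =
      (v - ((u ⬝ᵥ A *ᵥ v) / (u ⬝ᵥ A *ᵥ u)) • u) ⬝ᵥ
        G *ᵥ (v - ((u ⬝ᵥ A *ᵥ v) / (u ⬝ᵥ A *ᵥ u)) • u)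
      + (u ⬝ᵥ A *ᵥ v) ^ 2 / (u ⬝ᵥ A *ᵥ u) := by
    intro v
    rw [broyd_bilin A G hA hG u hu, quad_proj G hG.1]
    field_simp
    ring
  have keyA : ∀ v, v ⬝ᵥ A *ᵥ v =
      (v - ((u ⬝ᵥ A *ᵥ v) / (u ⬝ᵥ A *ᵥ u)) • u) ⬝ᵥ
        A *ᵥ (v - ((u ⬝ᵥ A *ᵥ v) / (u ⬝ᵥ A *ᵥ u)) • u)
      + (u ⬝ᵥ A *ᵥ v) ^ 2 / (u ⬝ᵥ A *ᵥ u) := by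
    intro v
    rw [quad_proj A hA.1]
    field_simp
    ring
  refine ⟨broyd_herm A G hA hG u hu, fun v => ?_, fun v => ?_⟩
  · rw [key, keyA]
    have := h.2.1 (v - ((u ⬝ᵥ A *ᵥ v) / (u ⬝ᵥ A *ᵥ u)) • u)
    linarith
  · rw [key, keyA v]
    have := h.2.2 (v - ((u ⬝ᵥ A *ᵥ v) / (u ⬝ᵥ A *ᵥ u)) • u)
    have h2 : 0 ≤ (u ⬝ᵥ A *ᵥ v) ^ 2 / (u ⬝ᵥ A *ᵥ u) := by positivity
    nlinarith

lemma energy_step {n : ℕ} (η : ℝ) (A G : Matrix (Fin n) (Fin n) ℝ) (hA : A.PosDef)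
    (h : QInv η A G) (u v : Fin n → ℝ)
    (hv : (broyd 1 A G u) *ᵥ v = G *ᵥ u - A *ᵥ u) :
    0 ≤ (A⁻¹ * G).trace - (A⁻¹ * broyd 1 A G u).trace ∧
    v ⬝ᵥ (broyd 1 A G u) *ᵥ v ≤
      ((A⁻¹ * G).trace - (A⁻¹ * broyd 1 A G u).trace) * (u ⬝ᵥ G *ᵥ u) := by
  by_cases hu : u = 0
  · rw [hv]
    simp [broyd, hu]
  have hG := posDef_of_ge A G hA h.1 h.2.1
  have ha : 0 < u ⬝ᵥ A *ᵥ u := by simpa using hA.dotProduct_mulVec_pos hu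
  have hga := h.2.1 u
  rw [broyd_trace A G hA hG u hu]
  have h1 := broyd_bilin A G hA hG u hu u v
  have h2 := broyd_bilin A G hA hG u hu v v
  have h3 : v ⬝ᵥ (broyd 1 A G u) *ᵥ v = u ⬝ᵥ G *ᵥ v - u ⬝ᵥ A *ᵥ v := by
    rw [hv, dotProduct_sub, aux_symm_s18 hG.1, aux_symm_s18 hA.1]
  rw [hv, dotProduct_sub] at h1
  rw [h3] at h2
  rw [h3]
  set a := u ⬝ᵥ A *ᵥ u with hadef
  set g := u ⬝ᵥ G *ᵥ u with hgdef
  set p := u ⬝ᵥ G *ᵥ v with hp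
  set q := v ⬝ᵥ G *ᵥ v with hq
  have hb : u ⬝ᵥ A *ᵥ v = g - a := by
    rw [h1]; field_simp; ring
  rw [hb] at h2 ⊢
  -- vector u - s with s = v - (β/a) u
  set c := (g - a) / a with hc
  have hga2 : g = (c + 1) * a := by rw [hc]; field_simp; ring
  have hc0 : 0 ≤ c := div_nonneg (by linarith) ha.le
  have hgdiv : g / a - 1 = c := by rw [hc]; field_simp
  have h5 := h.2.1 (v - (c + 1) • u)
  rw [quad_proj G hG.1, quad_proj A hA.1, hb] at h5
  have h6 := h.2.1 (v - c • u)
  have h7 : 0 ≤ (v - c • u) ⬝ᵥ A *ᵥ (v - c • u) := by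
    simpa using hA.posSemidef.dotProduct_mulVec_nonneg (v - c • u)
  rw [quad_proj A hA.1, hb] at h7
  rw [hgdiv, sub_sub_cancel]
  refine ⟨hc0, ?_⟩
  have h8 : g / a = c + 1 := by linarith
  have h9 : p - (g - a) = q - 2 * c * p + (c + 2) * c ^ 2 * a := by
    rw [h2, h8, hga2]; field_simp; ring
  simp only [← hadef, ← hgdef, ← hp, ← hq] at h5 h7
  have : g - a = c * a := by linarith
  rw [this] at h5 h7 h9 ⊢
  rw [hga2] at h5 ⊢
  nlinarith

lemma aux_amgm (r : ℕ → ℝ) (hr : ∀ i, 0 ≤ r i) (k : ℕ) (hk : 0 < k) :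
    ∏ i ∈ Finset.range k, r i ≤ ((∑ i ∈ Finset.range k, r i) / k) ^ k := by
  have hk' : (0 : ℝ) < k := by exact_mod_cast hk
  have h := Real.geom_mean_le_arith_mean (Finset.range k) (fun _ => 1) r (by simp)
    (by simpa using hk') (fun i _ => hr i)
  simp only [Real.rpow_one, one_mul, Finset.sum_const, Finset.card_range, nsmul_eq_mul,
    mul_one] at h
  have hp : 0 ≤ ∏ i ∈ Finset.range k, r i := Finset.prod_nonneg fun i _ => hr i
  calc ∏ i ∈ Finset.range k, r i
      = ((∏ i ∈ Finset.range k, r i) ^ ((k : ℝ)⁻¹)) ^ k := by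
        rw [Real.rpow_inv_natCast_pow hp hk.ne']
    _ ≤ _ := pow_le_pow_left₀ (Real.rpow_nonneg hp _) h k

/-- Comparison of the local norms. -/
lemma aux_norms {n : ℕ} (η : ℝ) (hη : 1 ≤ η) (A G : Matrix (Fin n) (Fin n) ℝ) (hA : A.PosDef)
    (h : QInv η A G) (u g : Fin n → ℝ) (hu : G *ᵥ u = -g) :
    g ⬝ᵥ A⁻¹ *ᵥ g ≤ η * (u ⬝ᵥ G *ᵥ u) ∧ u ⬝ᵥ G *ᵥ u ≤ g ⬝ᵥ A⁻¹ *ᵥ g := by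
  have hi2 : A * A⁻¹ = 1 := Matrix.mul_nonsing_inv _ hA.det_pos.ne'.isUnit
  set y := A⁻¹ *ᵥ g with hy
  have hAy : A *ᵥ y = g := by rw [hy, Matrix.mulVec_mulVec, hi2, Matrix.one_mulVec]
  have e0 : g ⬝ᵥ y = y ⬝ᵥ A *ᵥ y := by rw [hAy, dotProduct_comm]
  have hG := posDef_of_ge A G hA h.1 h.2.1
  have e1 : y ⬝ᵥ G *ᵥ u = -(y ⬝ᵥ A *ᵥ y) := by rw [hu, hAy, dotProduct_neg]
  have e2 : u ⬝ᵥ G *ᵥ u = -(u ⬝ᵥ A *ᵥ y) := by rw [hu, hAy, dotProduct_neg]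
  have h1 : 0 ≤ (u - (-1 / η) • y) ⬝ᵥ G *ᵥ (u - (-1 / η) • y) := by
    simpa using hG.posSemidef.dotProduct_mulVec_nonneg (u - (-1 / η) • y)
  have h2 : 0 ≤ (u - (-1 : ℝ) • y) ⬝ᵥ A *ᵥ (u - (-1 : ℝ) • y) := by
    simpa using hA.posSemidef.dotProduct_mulVec_nonneg (u - (-1 : ℝ) • y)
  rw [quad_proj G hG.1, e1] at h1
  rw [quad_proj A hA.1, aux_symm_s18 hA.1 y u] at h2
  have h3 := h.2.2 y
  have h4 := h.2.1 u
  rw [e0]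
  constructor
  · have hη0 : 0 < η := by linarith
    have h5 : (-1 / η) ^ 2 * (y ⬝ᵥ G *ᵥ y) ≤ (-1 / η) ^ 2 * (η * (y ⬝ᵥ A *ᵥ y)) :=
      mul_le_mul_of_nonneg_left h3 (sq_nonneg _)
    have h6 : (-1 / η) ^ 2 * (η * (y ⬝ᵥ A *ᵥ y)) = (y ⬝ᵥ A *ᵥ y) / η := by field_simp
    have h7 : 2 * (-1 / η) * -(y ⬝ᵥ A *ᵥ y) = 2 * ((y ⬝ᵥ A *ᵥ y) / η) := by field_simp
    have h8 : (y ⬝ᵥ A *ᵥ y) / η ≤ u ⬝ᵥ G *ᵥ u := by linarith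
    rw [div_le_iff₀ hη0] at h8
    linarith
  · linarith

lemma aux_scalar_s18 (n k : ℕ) (hn : 1 ≤ n) (η : ℝ) (hη : 1 < η)
    (hk : 4 * n * η * Real.log η ≤ (k : ℝ)) (hk0 : 0 < k) :
    η * ((n * (η - 1)) / k) ^ k ≤ (4 * n * η / k * Real.log η) ^ k := by
  have hk' : (0 : ℝ) < k := by exact_mod_cast hk0
  have hn' : (1 : ℝ) ≤ n := by exact_mod_cast hn
  have hη0 : 0 < η := by linarith
  have hl : 0 < Real.log η := Real.log_pos hη
  have h1 : η - 1 ≤ η * Real.log η := by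
    have := Real.one_sub_inv_le_log_of_pos hη0
    have h2 := mul_le_mul_of_nonneg_left this hη0.le
    have h3 : η * (1 - η⁻¹) = η - 1 := by field_simp
    linarith
  have h2 : (n * (η - 1)) / k ≤ n * η / k * Real.log η := by
    rw [div_mul_eq_mul_div]
    refine div_le_div_of_nonneg_right ?_ hk'.le
    nlinarith
  have h3 : η ≤ (4 : ℝ) ^ k := by
    have h4 : Real.log η ≤ k := by
      have : 1 ≤ n * η := by nlinarith
      nlinarith
    calc η = Real.exp (Real.log η) := (Real.exp_log hη0).symm
      _ ≤ Real.exp k := Real.exp_le_exp.2 h4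
      _ = (Real.exp 1) ^ k := by rw [← Real.exp_nat_mul, mul_one]
      _ ≤ 4 ^ k := by
        refine pow_le_pow_left₀ (Real.exp_pos 1).le ?_ k
        linarith [Real.exp_one_lt_d9]
  calc η * ((n * (η - 1)) / k) ^ k ≤ 4 ^ k * (n * η / k * Real.log η) ^ k := by
        have : 0 ≤ η - 1 := by linarith
        gcongr
    _ = _ := by rw [← mul_pow]; ring

theorem quad_scheme_dfp_superlinear {n : ℕ} (hn : 1 ≤ n)
    (B A : Matrix (Fin n) (Fin n) ℝ) (hB : B.PosDef) (hA : A.PosDef)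
    (μ L : ℝ) (hμ : 0 < μ) (hL : 0 < L)
    (hμB : psdLE (μ • B) A) (hLB : psdLE A (L • B))
    (b : Fin n → ℝ) (τ : ℕ → ℝ) (hτ : ∀ k, τ k ∈ Set.Icc (0 : ℝ) 1)
    (x : ℕ → Fin n → ℝ) (G : ℕ → Matrix (Fin n) (Fin n) ℝ)
    (hG0 : G 0 = L • B)
    (hx : ∀ k, x (k + 1) = x k - (G k)⁻¹.mulVec (A.mulVec (x k) - b))
    (hGrec : ∀ k, G (k + 1) = broyd (τ k) A (G k) (x (k + 1) - x k))
    (lam : ℕ → ℝ)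
    (hlam : ∀ k, lam k =
      Real.sqrt ((A.mulVec (x k) - b) ⬝ᵥ A⁻¹.mulVec (A.mulVec (x k) - b)))
    (hτ1 : ∀ k, τ k = 1) (hLμ : μ < L)
    (k : ℕ) (hk : 4 * n * L / μ * Real.log (L / μ) ≤ (k : ℝ)) :
    lam k ≤ ((4 * n * L / (μ * k) : ℝ) * Real.log (L / μ)) ^ ((k : ℝ) / 2) * lam 0 := by
  have hη : 1 < L / μ := by rwa [one_lt_div hμ]
  have hη0 : 0 < L / μ := by linarith
  set η := L / μ with hηdef
  have hlog : 0 < Real.log η := Real.log_pos hη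
  have hn' : (1 : ℝ) ≤ n := by exact_mod_cast hn
  have hk2 : 4 * n * η * Real.log η ≤ (k : ℝ) := by
    rw [hηdef] at hk ⊢
    calc _ = _ := by ring
      _ ≤ _ := hk
  have hk' : (0 : ℝ) < k := lt_of_lt_of_le (by positivity) hk2
  have hk0 : 0 < k := by exact_mod_cast hk'
  -- invariant
  have hq : ∀ i, QInv η A (G i) := by
    intro i
    induction i with
    | zero =>
      rw [hG0]
      refine ⟨?_, fun v => ?_, fun v => ?_⟩
      · have := hB.1
        simp only [Matrix.IsHermitian, Matrix.conjTranspose_eq_transpose_of_trivial,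
          Matrix.transpose_smul] at this ⊢
        rw [this]
      · have := hLB.dotProduct_mulVec_nonneg v
        simp only [star_trivial, Matrix.sub_mulVec, dotProduct_sub] at this
        linarith
      · have := hμB.dotProduct_mulVec_nonneg v
        simp only [star_trivial, Matrix.sub_mulVec, dotProduct_sub, Matrix.smul_mulVec,
          dotProduct_smul, smul_eq_mul] at this ⊢
        have h2 := mul_le_mul_of_nonneg_left (sub_nonneg.1 this) hη0.le
        calc L * (v ⬝ᵥ B *ᵥ v) = η * (μ * (v ⬝ᵥ B *ᵥ v)) := by rw [hηdef]; field_simp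
          _ ≤ _ := h2
    | succ i ih =>
      rw [hGrec, hτ1]
      exact QInv_step η hη.le A (G i) hA ih _
  have hpd : ∀ i, (G i).PosDef := fun i => posDef_of_ge A (G i) hA (hq i).1 (hq i).2.1
  have hGu : ∀ i, G i *ᵥ (x (i + 1) - x i) = -(A *ᵥ (x i) - b) := by
    intro i
    rw [hx i, sub_sub_cancel_left, Matrix.mulVec_neg, Matrix.mulVec_mulVec,
      Matrix.mul_nonsing_inv _ (hpd i).det_pos.ne'.isUnit, Matrix.one_mulVec]
  set e : ℕ → ℝ := fun i => (x (i + 1) - x i) ⬝ᵥ G i *ᵥ (x (i + 1) - x i) with he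
  set r : ℕ → ℝ := fun i => (A⁻¹ * G i).trace - (A⁻¹ * G (i + 1)).trace with hr
  have hstep : ∀ i, 0 ≤ r i ∧ e (i + 1) ≤ r i * e i := by
    intro i
    have hGi : G (i + 1) = broyd 1 A (G i) (x (i + 1) - x i) := by rw [hGrec, hτ1]
    have := energy_step η A (G i) hA (hq i) (x (i + 1) - x i) (x (i + 1 + 1) - x (i + 1)) (by
      rw [← hGi, hGu, hGu, Matrix.mulVec_sub]
      abel)
    rw [← hGi] at this
    exact this
  have hprod : ∀ i, e i ≤ (∏ j ∈ Finset.range i, r j) * e 0 := by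
    intro i
    induction i with
    | zero => simp
    | succ i ih =>
      rw [Finset.prod_range_succ]
      calc e (i + 1) ≤ r i * e i := (hstep i).2
        _ ≤ r i * ((∏ j ∈ Finset.range i, r j) * e 0) :=
          mul_le_mul_of_nonneg_left ih (hstep i).1
        _ = _ := by ring
  have hi : A⁻¹ * A = 1 := Matrix.nonsing_inv_mul _ hA.det_pos.ne'.isUnit
  have hsum : ∑ j ∈ Finset.range k, r j ≤ n * (η - 1) := by
    rw [hr, Finset.sum_range_sub' (fun i => (A⁻¹ * G i).trace)]
    have h1 : 0 ≤ (A⁻¹ * (G k - A)).trace := by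
      refine aux_trace_nonneg _ _ hA.inv.posSemidef
        (Matrix.PosSemidef.of_dotProduct_mulVec_nonneg ((hpd k).1.sub hA.1) fun v => ?_)
      simp only [star_trivial, Matrix.sub_mulVec, dotProduct_sub]
      linarith [(hq k).2.1 v]
    have h2 : 0 ≤ (A⁻¹ * (η • A - G 0)).trace := by
      refine aux_trace_nonneg _ _ hA.inv.posSemidef
        (Matrix.PosSemidef.of_dotProduct_mulVec_nonneg ?_ fun v => ?_)
      · refine Matrix.IsHermitian.sub ?_ (hpd 0).1
        have := hA.1
        simp only [Matrix.IsHermitian, Matrix.conjTranspose_eq_transpose_of_trivial,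
          Matrix.transpose_smul] at this ⊢
        rw [this]
      · simp only [star_trivial, Matrix.sub_mulVec, dotProduct_sub, Matrix.smul_mulVec,
          dotProduct_smul, smul_eq_mul]
        linarith [(hq 0).2.2 v]
    simp only [Matrix.mul_sub, Matrix.mul_smul, hi, Matrix.trace_sub, Matrix.trace_smul,
      Matrix.trace_one, Fintype.card_fin, smul_eq_mul] at h1 h2
    linarith
  have hr0 : ∀ i, 0 ≤ r i := fun i => (hstep i).1
  have hsum0 : 0 ≤ ∑ j ∈ Finset.range k, r j := Finset.sum_nonneg fun i _ => hr0 i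
  have he0 : 0 ≤ e 0 := by
    have := (hpd 0).posSemidef.dotProduct_mulVec_nonneg (x (0 + 1) - x 0)
    rwa [star_trivial] at this
  have hnk := (aux_norms η hη.le A (G k) hA (hq k) _ _ (hGu k)).1
  have hn0 := (aux_norms η hη.le A (G 0) hA (hq 0) _ _ (hGu 0)).2
  set X := 4 * n * η / k * Real.log η with hX
  have hX0 : 0 ≤ X := by positivity
  have hXeq : (4 * n * L / (μ * k) : ℝ) * Real.log η = X := by
    rw [hX, hηdef]; field_simp
  rw [hXeq, hlam, hlam]
  set s0 := (A *ᵥ (x 0) - b) ⬝ᵥ A⁻¹ *ᵥ (A *ᵥ (x 0) - b) with hs0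
  set sk := (A *ᵥ (x k) - b) ⬝ᵥ A⁻¹ *ᵥ (A *ᵥ (x k) - b) with hsk
  have hmain : sk ≤ X ^ k * s0 := by
    calc sk ≤ η * e k := hnk
      _ ≤ η * ((((n * (η - 1)) / k) ^ k) * e 0) := by
        refine mul_le_mul_of_nonneg_left ((hprod k).trans ?_) hη0.le
        refine mul_le_mul_of_nonneg_right ((aux_amgm r hr0 k hk0).trans ?_) he0
        gcongr
      _ = (η * ((n * (η - 1)) / k) ^ k) * e 0 := by ring
      _ ≤ X ^ k * e 0 :=
        mul_le_mul_of_nonneg_right (aux_scalar_s18 n k hn η hη hk2 hk0) he0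
      _ ≤ X ^ k * s0 := mul_le_mul_of_nonneg_left hn0 (pow_nonneg hX0 k)
  calc Real.sqrt sk ≤ Real.sqrt (X ^ k * s0) := Real.sqrt_le_sqrt hmain
    _ = Real.sqrt (X ^ k) * Real.sqrt s0 := Real.sqrt_mul (pow_nonneg hX0 k) _
    _ = X ^ ((k : ℝ) / 2) * Real.sqrt s0 := by
      rw [Real.sqrt_eq_rpow, ← Real.rpow_natCast, ← Real.rpow_mul hX0]
      congr 2
      ring
end
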